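/- arXiv:2506.05650 — 5 statements merged into one kernel-verified Lean document; each statement's English description precedes it below -/
import Mathlib

section
/- Let G be a finite group, k any field, and V a finite-dimensional faithful representation of G over k. If d is a natural number such that k[V]_{≤d} spans k(V) as a K-vector space, then the group algebra kG is isomorphic, as a kG-module, to a direct summand of k[V]_{≤d}. In particular, D_reg(G,V) ≤ D_span(G,V), with no hypothesis on the characteristic of k. -/
namespace RegSummand

open MonoidAlgebra

section Alg

variable {k : Type*} [Field k] {G : Type*} [Group G] [Fintype G]

/-- Self-injectivity of the group algebra of a finite group. -/
theorem groupAlgebra_extend {X Y : Type*} [AddCommGroup X] [AddCommGroup Y]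
    [Module k X] [Module (MonoidAlgebra k G) X] [IsScalarTower k (MonoidAlgebra k G) X]
    [Module k Y] [Module (MonoidAlgebra k G) Y] [IsScalarTower k (MonoidAlgebra k G) Y]
    (f : X →ₗ[MonoidAlgebra k G] Y) (hf : Function.Injective f)
    (φ : X →ₗ[MonoidAlgebra k G] MonoidAlgebra k G) :
    ∃ ψ : Y →ₗ[MonoidAlgebra k G] MonoidAlgebra k G, ∀ x, ψ (f x) = φ x := by
  classical
  let ev : MonoidAlgebra k G →ₗ[k] k :=
    { toFun := fun a => a.coeff 1, map_add' := fun _ _ => by simp, map_smul' := fun _ _ => by simp }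
  obtain ⟨s, hs⟩ := LinearMap.exists_leftInverse_of_injective (f.restrictScalars k)
    (LinearMap.ker_eq_bot.2 hf)
  have hs' : ∀ x, s (f x) = x := fun x => LinearMap.congr_fun hs x
  let μ : Y →ₗ[k] k := ev ∘ₗ (φ.restrictScalars k) ∘ₗ s
  let h : Y →ₗ[k] MonoidAlgebra k G :=
    ∑ g : G, (LinearMap.toSpanSingleton k (MonoidAlgebra k G) (single g 1)) ∘ₗ μ ∘ₗ
      (Algebra.lsmul k k Y (single g⁻¹ (1 : k)))
  have happ : ∀ y g, (h y).coeff g = μ (single g⁻¹ (1 : k) • y) := by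
    intro y g
    simp [h, Finsupp.single_apply]
  refine ⟨equivariantOfLinearOfComm h ?_, ?_⟩
  · intro g y
    ext x
    simp [happ, smul_smul, single_mul_single]
  · intro x
    ext g
    rw [equivariantOfLinearOfComm_apply, happ]
    change (φ (s (single g⁻¹ (1 : k) • f x))).coeff 1 = _
    rw [← map_smul, hs']
    simp

/-- The rank of the action of `a`. -/
noncomputable def rk (k : Type*) [Field k] {A : Type*} [Ring A] [Algebra k A] (a : A) (X : Type*) [AddCommGroup X]
    [Module k X] [Module A X] [IsScalarTower k A X] : ℕ :=
  Module.finrank k (LinearMap.range (Algebra.lsmul k k X a : X →ₗ[k] X))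

end Alg

section Rk
variable {k : Type*} [Field k] {A : Type*} [Ring A] [Algebra k A]
  {X Y : Type*} [AddCommGroup X] [AddCommGroup Y]
    [Module k X] [Module A X] [IsScalarTower k A X]
    [Module k Y] [Module A Y] [IsScalarTower k A Y]

theorem rk_congr (e : X ≃ₗ[A] Y) (a : A) : rk k a X = rk k a Y := by
  unfold rk
  have : LinearMap.range (Algebra.lsmul k k Y a : Y →ₗ[k] Y)
      = (LinearMap.range (Algebra.lsmul k k X a : X →ₗ[k] X)).map
        ((e.restrictScalars k) : X →ₗ[k] Y) := by
    ext y
    simp only [LinearMap.mem_range, Submodule.mem_map]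
    constructor
    · rintro ⟨z, rfl⟩
      exact ⟨a • e.symm z, ⟨e.symm z, rfl⟩, by simp⟩
    · rintro ⟨_, ⟨z, rfl⟩, rfl⟩
      exact ⟨e z, by simp⟩
  rw [this]
  exact (LinearEquiv.finrank_map_eq (e.restrictScalars k) _).symm

theorem rk_prod [Module.Finite k X] [Module.Finite k Y] (a : A) :
    rk k a (X × Y) = rk k a X + rk k a Y := by
  unfold rk
  have : (Algebra.lsmul k k (X × Y) a : (X × Y) →ₗ[k] (X × Y)) =
     LinearMap.prodMap (Algebra.lsmul k k X a : X →ₗ[k] X) (Algebra.lsmul k k Y a : Y →ₗ[k] Y) := by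
    ext <;> simp
  rw [this, LinearMap.range_prodMap, ← Module.finrank_prod]
  exact LinearEquiv.finrank_eq
    { toFun := fun z => (⟨z.1.1, z.2.1⟩, ⟨z.1.2, z.2.2⟩)
      invFun := fun z => ⟨(z.1.1, z.2.1), ⟨z.1.2, z.2.2⟩⟩
      map_add' := fun _ _ => rfl
      map_smul' := fun _ _ => rfl
      left_inv := fun _ => rfl
      right_inv := fun _ => rfl }

theorem rk_isCompl [Module.Finite k X] {N N' : Submodule A X} (h : IsCompl N N') (a : A) :
    rk k a X = rk k a N + rk k a N' := by
  have : Module.Finite k N := inferInstanceAs (Module.Finite k (N.restrictScalars k))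
  have : Module.Finite k N' := inferInstanceAs (Module.Finite k (N'.restrictScalars k))
  rw [← rk_prod, rk_congr (Submodule.prodEquivOfIsCompl N N' h)]

end Rk

section Main
variable {k : Type*} [Field k] {G : Type*} [Group G] [Fintype G]

/-- Any module has a nonzero indecomposable direct summand. -/
theorem exists_indec {A P : Type*} [Ring A] [AddCommGroup P] [Module A P] [IsArtinian A P]
    [Nontrivial P] : ∃ Q P' : Submodule A P, IsCompl Q P' ∧ Q ≠ ⊥ ∧
      ∀ X Y : Submodule A Q, IsCompl X Y → X = ⊥ ∨ X = ⊤ := by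
  obtain ⟨Q, ⟨⟨P', hc⟩, hQ⟩, hmin⟩ := (wellFounded_lt (α := Submodule A P)).has_min
    {Q | (∃ P', IsCompl Q P') ∧ Q ≠ ⊥} ⟨⊤, ⟨⊥, isCompl_top_bot⟩, top_ne_bot⟩
  refine ⟨Q, P', hc, hQ, fun X Y hXY => ?_⟩
  by_contra! hX
  refine hmin (X.map Q.subtype) ⟨⟨Y.map Q.subtype ⊔ P', ?_⟩, ?_⟩ ?_
  · have hd : Disjoint (X.map Q.subtype) (Y.map Q.subtype) :=
      (Submodule.disjoint_map Q.injective_subtype hXY.disjoint)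
    have hs : X.map Q.subtype ⊔ Y.map Q.subtype = Q := by
      rw [← Submodule.map_sup, hXY.sup_eq_top, Submodule.map_top, Submodule.range_subtype]
    constructor
    · refine hd.disjoint_sup_right_of_disjoint_sup_left ?_
      rw [hs]; exact hc.disjoint
    · rw [codisjoint_iff, ← sup_assoc, hs, hc.sup_eq_top]
  · intro h
    exact hX.1 (by
      exact Submodule.map_injective_of_injective Q.injective_subtype (by simpa using h))
  · refine lt_of_le_of_ne (Submodule.map_subtype_le _ _) fun h => hX.2 ?_
    exact Submodule.map_injective_of_injective Q.injective_subtype (by simpa using h)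

/-- Indecomposable injective modules are uniform. -/
theorem uniform_of_indec {A Q : Type*} [Ring A] [AddCommGroup Q] [Module A Q] [IsArtinian A Q]
    [IsNoetherian A Q] (hind : ∀ X Y : Submodule A Q, IsCompl X Y → X = ⊥ ∨ X = ⊤)
    (X Y : Submodule A Q)
    (hinj : ∀ (f : (X × Y) →ₗ[A] Q), Function.Injective f →
      ∀ φ : (X × Y) →ₗ[A] Q, ∃ ψ : Q →ₗ[A] Q, ∀ x, ψ (f x) = φ x)
    (hX : X ≠ ⊥) (hXY : Disjoint X Y) : Y = ⊥ := by
  by_contra hY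
  obtain ⟨ψ, hψ⟩ := hinj (LinearMap.coprod X.subtype Y.subtype)
    (by
      rw [← LinearMap.ker_eq_bot, LinearMap.ker_coprod_of_disjoint_range]
      · simp
      · simpa using hXY)
    (X.subtype ∘ₗ LinearMap.fst A X Y)
  have h1 : ∀ x ∈ X, ψ x = x := fun x hx => by simpa using hψ (⟨x, hx⟩, 0)
  have h2 : ∀ y ∈ Y, ψ y = 0 := fun y hy => by simpa using hψ (0, ⟨y, hy⟩)
  obtain ⟨N, hN⟩ := Filter.eventually_atTop.1 (LinearMap.eventually_isCompl_ker_pow_range_pow ψ)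
  have h3 : ∀ (n : ℕ), ∀ x ∈ X, (ψ ^ n) x = x := by
    intro n x hx
    induction n with
    | zero => simp
    | succ n ih => rw [pow_succ, Module.End.mul_apply, h1 x hx, ih]
  rcases hind _ _ (hN (N + 1) (Nat.le_succ N)) with h | h
  · refine hY (eq_bot_iff.2 fun y hy => ?_)
    rw [← h, LinearMap.mem_ker, pow_succ, Module.End.mul_apply, h2 y hy, map_zero]
  · refine hX (eq_bot_iff.2 fun x hx => ?_)
    have : x ∈ LinearMap.ker (ψ ^ (N + 1)) := h ▸ Submodule.mem_top
    rw [LinearMap.mem_ker, h3 _ x hx] at this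
    simpa using this

theorem exists_embedding_aux (n : ℕ) : ∀ {P : Type*} {M : Type*} [AddCommGroup P] [AddCommGroup M]
    [Module k P] [Module (MonoidAlgebra k G) P] [IsScalarTower k (MonoidAlgebra k G) P]
    [Module k M] [Module (MonoidAlgebra k G) M] [IsScalarTower k (MonoidAlgebra k G) M]
    [Module.Finite k P] [Module.Finite k M]
    (i : P →ₗ[MonoidAlgebra k G] MonoidAlgebra k G)
    (p : MonoidAlgebra k G →ₗ[MonoidAlgebra k G] P)
    (_ : ∀ x, p (i x) = x)
    (_ : ∀ a : MonoidAlgebra k G, rk k a P ≤ rk k a M)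
    (_ : Module.finrank k P ≤ n),
    ∃ f : P →ₗ[MonoidAlgebra k G] M, Function.Injective f := by
  induction n with
  | zero =>
    intro P M _ _ _ _ _ _ _ _ _ _ i p hip hrk hn
    have : Subsingleton P := Module.finrank_zero_iff.1 (Nat.le_zero.1 hn)
    exact ⟨0, fun _ _ _ => Subsingleton.elim _ _⟩
  | succ n ih =>
    intro P M _ _ _ _ _ _ _ _ _ _ i p hip hrk hn
    rcases subsingleton_or_nontrivial P with hP | hP
    · exact ⟨0, fun _ _ _ => Subsingleton.elim _ _⟩
    have : IsArtinian (MonoidAlgebra k G) P := isArtinian_of_tower k inferInstance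
    have : IsNoetherian (MonoidAlgebra k G) P := isNoetherian_of_tower k inferInstance
    obtain ⟨Q, P', hc, hQ, hind⟩ := exists_indec (A := MonoidAlgebra k G) (P := P)
    have : Module.Finite k Q := inferInstanceAs (Module.Finite k (Q.restrictScalars k))
    have : Module.Finite k P' := inferInstanceAs (Module.Finite k (P'.restrictScalars k))
    let iQ : Q →ₗ[MonoidAlgebra k G] MonoidAlgebra k G := i ∘ₗ Q.subtype
    let pQ : MonoidAlgebra k G →ₗ[MonoidAlgebra k G] Q :=
      Submodule.projectionOnto Q P' hc ∘ₗ p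
    have hQid : ∀ x, pQ (iQ x) = x := fun x => by simp [pQ, iQ, hip]
    -- an atom in `Q`
    have : Nontrivial Q := Submodule.nontrivial_iff_ne_bot.2 hQ
    obtain ⟨L, hL, -⟩ := (eq_bot_or_exists_atom_le (⊤ : Submodule (MonoidAlgebra k G) Q)).resolve_left
      top_ne_bot
    obtain ⟨l, hlL, hl0⟩ := Submodule.exists_mem_ne_zero_of_ne_bot hL.1
    have hal : iQ l • pQ 1 = l := by
      rw [← map_smul, smul_eq_mul, mul_one, hQid]
    -- the element `iQ l` acts nontrivially on `M`
    obtain ⟨m, hm⟩ : ∃ m : M, iQ l • m ≠ 0 := by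
      by_contra! hcon
      have h0 : rk k (iQ l) M = 0 := by
        unfold rk
        have : (Algebra.lsmul k k M (iQ l) : M →ₗ[k] M) = 0 := by
          ext m; simpa using hcon m
        rw [this, LinearMap.range_zero, finrank_bot]
      have h1 := hrk (iQ l)
      rw [h0, Nat.le_zero] at h1
      unfold rk at h1
      rw [Submodule.finrank_eq_zero, LinearMap.range_eq_bot] at h1
      have h2 := LinearMap.congr_fun h1 ((pQ 1 : Q) : P)
      have h3 : iQ l • ((pQ 1 : Q) : P) = 0 := by simpa using h2
      rw [← Submodule.coe_smul, hal] at h3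
      exact hl0 (by simpa using h3)
    let f : Q →ₗ[MonoidAlgebra k G] M :=
      LinearMap.toSpanSingleton (MonoidAlgebra k G) M m ∘ₗ iQ
    have hf : Function.Injective f := by
      rw [← LinearMap.ker_eq_bot]
      refine uniform_of_indec hind L (LinearMap.ker f) ?_ hL.1 ?_
      · intro u hu φ
        obtain ⟨ψ, hψ⟩ := groupAlgebra_extend (k := k) (X := L × LinearMap.ker f) (Y := Q) u hu
          (iQ ∘ₗ (show (L × LinearMap.ker f) →ₗ[MonoidAlgebra k G] Q from φ))
        exact ⟨pQ ∘ₗ ψ, fun x => by simp [hψ, hQid]⟩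
      · refine (IsAtom.not_le_iff_disjoint hL).1 fun hle => ?_
        exact hm (by simpa [f] using hle hlL)
    obtain ⟨ψ, hψ⟩ := groupAlgebra_extend (k := k) f hf iQ
    let r : M →ₗ[MonoidAlgebra k G] Q := pQ ∘ₗ ψ
    have hr : ∀ x, r (f x) = x := fun x => by simp [r, hψ, hQid]
    have hcM : IsCompl (LinearMap.range f) (LinearMap.ker r) := by
      constructor
      · rw [Submodule.disjoint_def]
        rintro _ ⟨x, rfl⟩ hx
        rw [LinearMap.mem_ker, hr] at hx
        rw [hx, map_zero]
      · rw [codisjoint_iff, eq_top_iff]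
        intro x _
        rw [Submodule.mem_sup]
        exact ⟨f (r x), ⟨_, rfl⟩, x - f (r x), by simp [hr], by simp⟩
    have : Module.Finite k (LinearMap.ker r) :=
      inferInstanceAs (Module.Finite k ((LinearMap.ker r).restrictScalars k))
    obtain ⟨f', hf'⟩ := ih (P := P') (M := LinearMap.ker r) (i ∘ₗ P'.subtype)
      (Submodule.projectionOnto P' Q hc.symm ∘ₗ p) (fun x => by simp [hip])
      (fun a => by
        have h1 := hrk a
        rw [rk_isCompl hc, rk_isCompl hcM, ← rk_congr (LinearEquiv.ofInjective f hf)] at h1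
        omega)
      (by
        have h1 : Module.finrank k (Q × P') = Module.finrank k P :=
          LinearEquiv.finrank_eq ((Submodule.prodEquivOfIsCompl Q P' hc).restrictScalars k)
        rw [Module.finrank_prod] at h1
        have h2 : 0 < Module.finrank k Q := Module.finrank_pos
        omega)
    let e := (Submodule.prodEquivOfIsCompl Q P' hc).symm
    refine ⟨(LinearMap.coprod f ((LinearMap.ker r).subtype ∘ₗ f')) ∘ₗ e.toLinearMap, ?_⟩
    rw [LinearMap.coe_comp]
    refine Function.Injective.comp ?_ e.injective
    rw [← LinearMap.ker_eq_bot, LinearMap.ker_coprod_of_disjoint_range]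
    · rw [LinearMap.ker_eq_bot.2 hf, LinearMap.ker_comp, Submodule.ker_subtype,
        Submodule.comap_bot, LinearMap.ker_eq_bot.2 hf']
      simp
    · refine hcM.disjoint.mono_right ?_
      rintro _ ⟨x, rfl⟩
      exact (f' x).2

theorem exists_embedding {M : Type*} [AddCommGroup M]
    [Module k M] [Module (MonoidAlgebra k G) M] [IsScalarTower k (MonoidAlgebra k G) M]
    [Module.Finite k M]
    (h : ∀ a : MonoidAlgebra k G, rk k a (MonoidAlgebra k G) ≤ rk k a M) :
    ∃ f : MonoidAlgebra k G →ₗ[MonoidAlgebra k G] M, Function.Injective f := by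
  have : Module.Finite k (MonoidAlgebra k G) := inferInstance
  exact exists_embedding_aux _ LinearMap.id LinearMap.id (fun _ => rfl) h le_rfl

theorem rk_le_of_span {K : Type*} [Field K] [Algebra k K] {F M : Type*} [AddCommGroup F]
    [AddCommGroup M]
    [Module k F] [Module (MonoidAlgebra k G) F] [IsScalarTower k (MonoidAlgebra k G) F]
    [Module k M] [Module (MonoidAlgebra k G) M] [IsScalarTower k (MonoidAlgebra k G) M]
    [Module.Finite k M] [Module K F] [IsScalarTower k K F] [SMulCommClass (MonoidAlgebra k G) K F]
    (b : Module.Basis G K F) (w : F) (hb : ∀ g, b g = single g (1 : k) • w)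
    (ι : M →ₗ[MonoidAlgebra k G] F) (hι : Submodule.span K (Set.range ι) = ⊤)
    (a : MonoidAlgebra k G) : rk k a (MonoidAlgebra k G) ≤ rk k a M := by
  classical
  let R := LinearMap.range (Algebra.lsmul k k (MonoidAlgebra k G) a : MonoidAlgebra k G →ₗ[k] _)
  let T := LinearMap.range (Algebra.lsmul k k M a : M →ₗ[k] M)
  change Module.finrank k R ≤ Module.finrank k T
  let v := Module.finBasis k R
  let t := Module.finBasis k T
  obtain ⟨s, hs⟩ := LinearMap.exists_leftInverse_of_injective R.subtype (Submodule.ker_subtype R)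
  have hs' : ∀ x : R, s x = x := fun x => LinearMap.congr_fun hs x
  let S : Submodule K F := Submodule.span K (Set.range fun j => ι (t j : M))
  have hfin : FiniteDimensional K F := Module.Finite.of_basis b
  have hS : ∀ x : F, a • x ∈ S := by
    intro x
    have hx : x ∈ Submodule.span K (Set.range ι) := hι ▸ Submodule.mem_top
    induction hx using Submodule.span_induction with
    | mem x hx =>
      obtain ⟨m, rfl⟩ := hx
      rw [← map_smul]
      have h1 : (⟨a • m, ⟨m, rfl⟩⟩ : T) = ∑ j, t.repr ⟨a • m, ⟨m, rfl⟩⟩ j • t j :=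
        (t.sum_repr _).symm
      have h2 : a • m = ∑ j, t.repr ⟨a • m, ⟨m, rfl⟩⟩ j • (t j : M) := by
        refine (congrArg Subtype.val h1).trans ?_
        rw [AddSubmonoidClass.coe_finsetSum]
        rfl
      rw [h2, map_sum]
      refine Submodule.sum_mem _ fun j _ => ?_
      have h3 : ∀ (c : k) (y : M), ι (c • y) = algebraMap k K c • ι y := by
        intro c y
        rw [algebraMap_smul, LinearMap.map_smul_of_tower]
      rw [h3]
      exact Submodule.smul_mem _ _ (Submodule.subset_span ⟨j, rfl⟩)
    | zero => simp
    | add x y _ _ hx hy => rw [smul_add]; exact S.add_mem hx hy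
    | smul c x _ hx => rw [smul_comm]; exact S.smul_mem c hx
  let u : Fin (Module.finrank k R) → S := fun j =>
    ⟨(v j : MonoidAlgebra k G) • w, by
      obtain ⟨x, hx⟩ := (v j).2
      rw [← hx]
      change (a * x) • w ∈ S
      rw [mul_smul]
      exact hS _⟩
  let τ : Fin (Module.finrank k R) → F →ₗ[K] K := fun i =>
    b.constr K fun g => algebraMap k K (v.repr (s (single g 1)) i)
  have hτ : ∀ i (x : MonoidAlgebra k G), τ i (x • w) = algebraMap k K (v.repr (s x) i) := by
    intro i x
    induction x using MonoidAlgebra.induction_linear with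
    | zero => simp
    | add x y hx hy => simp [add_smul, hx, hy]
    | single g c =>
      have h1 : (single g c : MonoidAlgebra k G) = c • single g 1 := by simp
      rw [h1, smul_assoc, ← hb, ← algebraMap_smul K c (b g), map_smul]
      simp only [τ, Module.Basis.constr_basis]
      rw [map_smul s, map_smul, Finsupp.smul_apply, smul_eq_mul, smul_eq_mul, map_mul]
  have hu : LinearIndependent K u := by
    rw [Fintype.linearIndependent_iff]
    intro c hc i
    have h1 : ∑ j, c j • ((v j : MonoidAlgebra k G) • w) = 0 := by
      simpa [u] using congrArg Subtype.val hc
    have h2 := congrArg (τ i) h1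
    rw [map_sum, map_zero] at h2
    simpa [hτ, hs', Finsupp.single_apply] using h2
  calc Module.finrank k R = Fintype.card (Fin (Module.finrank k R)) := by simp
    _ ≤ Module.finrank K S := hu.fintype_card_le_finrank
    _ ≤ Fintype.card (Fin (Module.finrank k T)) := finrank_range_le_card _
    _ = _ := by simp

theorem exists_free_orbit {K : Type*} [Field K] [Algebra k K] {E F : Type*} [AddCommGroup E]
    [AddCommGroup F] [Module k E] [Module k F] [DistribMulAction G E] [DistribMulAction G F]
    [SMulCommClass G k E] [SMulCommClass G k F] [Module K F] [IsScalarTower k K F]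
    [SMulCommClass G K F] (M : Submodule k E) [Module.Finite k M]
    (hM : ∀ (g : G), ∀ p ∈ M, g • p ∈ M) (ι : E →ₗ[k] F) (hι : ∀ (g : G) p, ι (g • p) = g • ι p)
    (b : Module.Basis G K F) (w : F) (hb : ∀ g, b g = g • w)
    (hspan : Submodule.span K (ι '' (M : Set E)) = ⊤) :
    ∃ w₀ ∈ M, LinearIndependent k (fun g : G => g • w₀) := by
  classical
  let ρF : Representation k G F := Representation.ofDistribMulAction k G F
  let ρM : Representation k G M :=
    { toFun := fun g => (Representation.ofDistribMulAction k G E g).restrict (hM g)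
      map_one' := by ext x; simp [LinearMap.restrict_apply]
      map_mul' := fun g h => by ext x; exact mul_smul g h (x : E) }
  let _ : Module K ρF.asModule := inferInstanceAs (Module K F)
  have hKF : IsScalarTower k K ρF.asModule := inferInstanceAs (IsScalarTower k K F)
  have hsF : ∀ (g : G) (c : k) (x : F),
      (single g c : MonoidAlgebra k G) • (show ρF.asModule from x) = c • (g • x) := fun g c x =>
    Representation.single_smul ρF c g x
  have hsM : ∀ (g : G) (c : k) (x : M),
      (single g c : MonoidAlgebra k G) • (show ρM.asModule from x) = c • (ρM g x) := fun g c x =>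
    Representation.single_smul ρM c g x
  have hcK : SMulCommClass (MonoidAlgebra k G) K ρF.asModule := by
    constructor
    intro a c x
    induction a using MonoidAlgebra.induction_linear with
    | zero => simp
    | add x y hx hy => simp [add_smul, hx, hy]
    | single g r =>
      have h1 := hsF g r (c • (show F from x))
      have h2 := hsF g r x
      have h3 : r • (g • (c • (show F from x))) = c • (r • (g • (show F from x))) := by
        rw [smul_comm g c, ← algebraMap_smul K r, ← algebraMap_smul K r (g • (show F from x)),
          smul_smul, smul_smul, mul_comm]
      exact h1.trans (h3.trans (congrArg (fun z : F => c • z) h2.symm))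
  let ι' : ρM.asModule →ₗ[MonoidAlgebra k G] ρF.asModule :=
    equivariantOfLinearOfComm
      (show ρM.asModule →ₗ[k] ρF.asModule from (ι ∘ₗ M.subtype : M →ₗ[k] F)) (fun g x => by
        have h1 := hsM g 1 x
        have h2 := hsF g 1 (ι (show M from x).1)
        rw [one_smul] at h1 h2
        exact (congrArg (ι ∘ₗ M.subtype) h1).trans ((hι g _).trans h2.symm))
  have hrange : Submodule.span K (Set.range ι') = ⊤ := by
    refine Eq.trans ?_ hspan
    congr 1
    ext x
    constructor
    · rintro ⟨m, rfl⟩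
      exact ⟨(show M from m).1, (show M from m).2, rfl⟩
    · rintro ⟨m, hm, rfl⟩
      exact ⟨(show ρM.asModule from (⟨m, hm⟩ : M)), rfl⟩
  have hb' : ∀ g, (show Module.Basis G K ρF.asModule from b) g
      = single g (1 : k) • (show ρF.asModule from w) := fun g => by
    have := hsF g 1 w
    rw [one_smul] at this
    exact (hb g).trans this.symm
  obtain ⟨f, hf⟩ := exists_embedding (k := k) (G := G) (M := ρM.asModule)
    (rk_le_of_span (K := K) _ _ hb' ι' hrange)
  let m₀ : M := f 1
  have hfs : ∀ g, ((show M from f (single g 1)) : E) = g • (m₀ : E) := by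
    intro g
    have h1 : (single g (1 : k) : MonoidAlgebra k G) = single g (1 : k) • 1 := by simp
    rw [h1, map_smul]
    have h2 := hsM g 1 m₀
    rw [one_smul] at h2
    exact congrArg (fun z : M => (z : E)) h2
  refine ⟨m₀, m₀.2, ?_⟩
  let f' : MonoidAlgebra k G →ₗ[k] E :=
    M.subtype ∘ₗ (show MonoidAlgebra k G →ₗ[k] M from f.restrictScalars k)
  have hf' : LinearMap.ker f' = ⊥ :=
    LinearMap.ker_eq_bot.2 (M.injective_subtype.comp hf)
  have h3 : LinearIndependent k (fun g : G => (single g (1 : k) : MonoidAlgebra k G)) := by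
    rw [Fintype.linearIndependent_iff]
    intro c hc g
    have := congrArg (fun a => a.coeff g) hc
    simpa [Finsupp.single_apply] using this
  have h4 := h3.map' f' hf'
  have h5 : (fun g : G => g • (m₀ : E)) =
      f' ∘ fun g : G => (single g (1 : k) : MonoidAlgebra k G) := by
    ext g
    exact (hfs g).symm
  rw [h5]
  exact h4

theorem summand_of_free_orbit {E : Type*} [AddCommGroup E] [Module k E] [DistribMulAction G E]
    [SMulCommClass G k E] (M : Submodule k E) (hM : ∀ (g : G), ∀ p ∈ M, g • p ∈ M)
    (w : E) (hw : w ∈ M) (hli : LinearIndependent k (fun g : G => g • w)) :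
    ∃ W C : Submodule k E, W ≤ M ∧ C ≤ M ∧
      (∀ (g : G), ∀ p ∈ W, g • p ∈ W) ∧
      (∀ (g : G), ∀ p ∈ C, g • p ∈ C) ∧
      W ⊓ C = ⊥ ∧ W ⊔ C = M ∧
      (∃ w₀ ∈ W, LinearIndependent k (fun g : G => g • w₀) ∧
        Submodule.span k (Set.range fun g : G => g • w₀) = W) := by
  classical
  let W : Submodule k E := Submodule.span k (Set.range fun g : G => g • w)
  obtain ⟨s, hs⟩ := LinearMap.exists_leftInverse_of_injective W.subtype (Submodule.ker_subtype W)
  have hs' : ∀ x : W, s x = x := fun x => LinearMap.congr_fun hs x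
  let B : Module.Basis G k W := Module.Basis.span hli
  have hB : ∀ g, (B g : E) = g • w := fun g => congrArg Subtype.val (Module.Basis.span_apply hli g)
  let μ : E →ₗ[k] k := B.coord 1 ∘ₗ s
  have hμ : ∀ g : G, μ (g • w) = if g = 1 then 1 else 0 := by
    intro g
    rw [← hB]
    simp [μ, hs', Finsupp.single_apply]
  let φ : E →ₗ[k] E := ∑ g : G, (LinearMap.toSpanSingleton k E (g • w)) ∘ₗ μ ∘ₗ
      (Representation.ofDistribMulAction k G E g⁻¹)
  have hφ : ∀ x, φ x = ∑ g : G, μ (g⁻¹ • x) • g • w := by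
    intro x; simp [φ]
  have hφG : ∀ (h : G) x, φ (h • x) = h • φ x := by
    intro h x
    rw [hφ, hφ, Finset.smul_sum, ← Equiv.sum_comp (Equiv.mulLeft h)]
    refine Finset.sum_congr rfl fun g _ => ?_
    simp only [Equiv.coe_mulLeft, mul_inv_rev, smul_smul, inv_mul_cancel_right]
    rw [smul_comm h, smul_smul]
  have hφw : φ w = w := by
    rw [hφ]
    simp [hμ]
  have hφW : ∀ x ∈ W, φ x = x := by
    intro x hx
    induction hx using Submodule.span_induction with
    | mem x hx => obtain ⟨g, rfl⟩ := hx; simp only [hφG, hφw]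
    | zero => simp
    | add x y _ _ hx hy => rw [map_add, hx, hy]
    | smul c x _ hx => rw [map_smul, hx]
  have hφr : ∀ x, φ x ∈ W := fun x => by
    rw [hφ]
    exact Submodule.sum_mem _ fun g _ => Submodule.smul_mem _ _ (Submodule.subset_span ⟨g, rfl⟩)
  have hWM : W ≤ M := Submodule.span_le.2 (by rintro _ ⟨g, rfl⟩; exact hM g w hw)
  refine ⟨W, M ⊓ LinearMap.ker φ, hWM, inf_le_left, ?_, ?_, ?_, ?_, w, ?_, hli, rfl⟩
  · intro g p hp
    rw [← hφW p hp, ← hφG]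
    exact hφr _
  · intro g p hp
    refine ⟨hM g p hp.1, ?_⟩
    have := hp.2
    rw [SetLike.mem_coe, LinearMap.mem_ker] at this ⊢
    rw [hφG, this, smul_zero]
  · rw [eq_bot_iff]
    rintro x ⟨hx, hx'⟩
    have := hx'.2
    rw [SetLike.mem_coe, LinearMap.mem_ker, hφW x hx] at this
    simpa using this
  · refine le_antisymm (sup_le hWM inf_le_left) fun x hx => ?_
    rw [Submodule.mem_sup]
    refine ⟨φ x, hφr x, x - φ x, ⟨M.sub_mem hx (hWM (hφr x)), ?_⟩, by simp⟩
    rw [SetLike.mem_coe, LinearMap.mem_ker, map_sub, hφW _ (hφr x), sub_self]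
  · exact Submodule.subset_span ⟨1, one_smul G w⟩

end Main

theorem totalDegree_smul_le' {k : Type*} [Field k] {n : ℕ} {G : Type*} [Group G]
    [MulSemiringAction G (MvPolynomial (Fin n) k)]
    [SMulCommClass G k (MvPolynomial (Fin n) k)]
    (hlin : ∀ (g : G) (i : Fin n),
      ((g • (MvPolynomial.X i : MvPolynomial (Fin n) k)).IsHomogeneous 1))
    (g : G) (p : MvPolynomial (Fin n) k) : (g • p).totalDegree ≤ p.totalDegree := by
  classical
  let φ : MvPolynomial (Fin n) k →ₐ[k] MvPolynomial (Fin n) k :=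
    MulSemiringAction.toAlgHom k (MvPolynomial (Fin n) k) g
  have hφ : φ = MvPolynomial.aeval
      (fun i => g • (MvPolynomial.X i : MvPolynomial (Fin n) k)) := by
    ext i : 1
    simp [φ]
  have h1 : g • p = φ p := rfl
  rw [h1, hφ, MvPolynomial.aeval_def, MvPolynomial.eval₂_eq]
  refine MvPolynomial.totalDegree_finsetSum_le fun s hs => ?_
  rw [MvPolynomial.algebraMap_eq, MvPolynomial.C_mul']
  refine (MvPolynomial.totalDegree_smul_le _ _).trans ?_
  refine (MvPolynomial.totalDegree_finsetProd _ _).trans ?_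
  refine le_trans ?_ (MvPolynomial.le_totalDegree hs)
  rw [Finsupp.sum]
  refine Finset.sum_le_sum fun i _ => ?_
  refine (MvPolynomial.totalDegree_pow _ _).trans ?_
  have := (hlin g i).totalDegree_le
  nlinarith

end RegSummand

open MvPolynomial

set_option synthInstance.maxHeartbeats 1000000
set_option maxHeartbeats 1000000

section

variable (k : Type*) [Field k] (n : ℕ) (G : Type*) [Group G] [Fintype G]
  [MulSemiringAction G (MvPolynomial (Fin n) k)]
  [MulSemiringAction G (FractionRing (MvPolynomial (Fin n) k))]

local notation "𝔸" => MvPolynomial (Fin n) k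
local notation "𝔽" => FractionRing (MvPolynomial (Fin n) k)
local notation "𝕂" => FixedPoints.subfield G (FractionRing (MvPolynomial (Fin n) k))
local notation "ιF" =>
  algebraMap (MvPolynomial (Fin n) k) (FractionRing (MvPolynomial (Fin n) k))

theorem regular_summand_aux
    [SMulCommClass G k (MvPolynomial (Fin n) k)]
    (hlin : ∀ (g : G) (i : Fin n), ((g • (X i : 𝔸)).IsHomogeneous 1))
    (hfaithful : ∀ g : G, (∀ p : 𝔸, g • p = p) → g = 1)
    (hcomp : ∀ (g : G) (p : 𝔸), g • (ιF p) = ιF (g • p))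
    (d : ℕ)
    (hspan : Submodule.span 𝕂 (ιF '' {p : 𝔸 | p.totalDegree ≤ d}) = ⊤) :
    (∃ W C : Submodule k 𝔸,
      W ≤ MvPolynomial.restrictTotalDegree (Fin n) k d ∧
      C ≤ MvPolynomial.restrictTotalDegree (Fin n) k d ∧
      (∀ (g : G), ∀ p ∈ W, g • p ∈ W) ∧
      (∀ (g : G), ∀ p ∈ C, g • p ∈ C) ∧
      W ⊓ C = ⊥ ∧ W ⊔ C = MvPolynomial.restrictTotalDegree (Fin n) k d ∧
      (∃ w₀ ∈ W, LinearIndependent k (fun g : G => g • w₀) ∧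
        Submodule.span k (Set.range fun g : G => g • w₀) = W)) := by
  classical
  have hset : {p : 𝔸 | p.totalDegree ≤ d} = (MvPolynomial.restrictTotalDegree (Fin n) k d : Set 𝔸) := by
    ext p
    rw [SetLike.mem_coe, MvPolynomial.mem_restrictTotalDegree]
    rfl
  rw [hset] at hspan
  have hM : ∀ (g : G), ∀ p ∈ MvPolynomial.restrictTotalDegree (Fin n) k d,
      g • p ∈ MvPolynomial.restrictTotalDegree (Fin n) k d := by
    intro g p hp
    rw [MvPolynomial.mem_restrictTotalDegree] at hp ⊢
    exact (RegSummand.totalDegree_smul_le' hlin g p).trans hp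
  have hfin : Module.Finite k (MvPolynomial.restrictTotalDegree (Fin n) k d) := inferInstance
  have hinj : Function.Injective ιF := IsFractionRing.injective 𝔸 𝔽
  have hfix : ∀ (g : G) (c : k), g • (algebraMap k 𝔽 c) = algebraMap k 𝔽 c := by
    intro g c
    rw [IsScalarTower.algebraMap_apply k 𝔸 𝔽, hcomp, Algebra.algebraMap_eq_smul_one (A := 𝔸) c, smul_comm,
      smul_one]
  have hfaith : FaithfulSMul G 𝔽 := by
    constructor
    intro g h hgh
    have : h⁻¹ * g = 1 := by
      refine hfaithful _ fun p => hinj ?_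
      rw [← hcomp, mul_smul, hgh, inv_smul_smul]
    exact (inv_mul_eq_one.1 this).symm
  have hcommF : SMulCommClass G k 𝔽 := by
    constructor
    intro g c x
    rw [Algebra.smul_def, Algebra.smul_def, smul_mul', hfix]
  let algK : Algebra k 𝕂 := RingHom.toAlgebra
    ((algebraMap k 𝔽).codRestrict 𝕂 (fun c g => hfix g c))
  have hcoe : ∀ c : k, ((algebraMap k 𝕂 c : 𝕂) : 𝔽) = algebraMap k 𝔽 c := fun c => rfl
  have htower : IsScalarTower k 𝕂 𝔽 := IsScalarTower.of_algebraMap_eq fun c => rfl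
  let b0 := IsGalois.normalBasis 𝕂 𝔽
  let e := FixedPoints.toAlgAutMulEquiv G 𝔽
  let b := b0.reindex e.toEquiv.symm
  have hb : ∀ g, b g = g • b0 1 := by
    intro g
    rw [Module.Basis.reindex_apply, IsGalois.normalBasis_apply]
    rfl
  obtain ⟨w₀, hw, hli⟩ := RegSummand.exists_free_orbit (K := 𝕂)
    (MvPolynomial.restrictTotalDegree (Fin n) k d) hM
    ((Algebra.linearMap 𝔸 𝔽).restrictScalars k) (fun g p => (hcomp g p).symm) b (b0 1) hb hspan
  exact RegSummand.summand_of_free_orbit _ hM w₀ hw hli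

/-- **Lemma (`D_reg ≤ D_span`, any characteristic).** Let `G` be a finite group, `k` any
field, and `V` a finite-dimensional faithful representation of `G` over `k`.  If the
polynomials of degree `≤ d` span `k(V)` over `K = k(V)^G`, then the group algebra `kG` is
isomorphic, as a `kG`-module, to a direct summand of `k[V]_{≤d}` (a `G`-stable subspace `W`
with a normal-basis element, plus a `G`-stable complement `C` inside `k[V]_{≤d}`).  In
particular `D_reg(G,V) ≤ D_span(G,V)`. -/
theorem regular_summand_of_spanning
    [SMulCommClass G k (MvPolynomial (Fin n) k)]
    (hlin : ∀ (g : G) (i : Fin n), ((g • (X i : 𝔸)).IsHomogeneous 1))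
    (hfaithful : ∀ g : G, (∀ p : 𝔸, g • p = p) → g = 1)
    (hcomp : ∀ (g : G) (p : 𝔸), g • (ιF p) = ιF (g • p))
    (d : ℕ)
    (hspan : Submodule.span 𝕂 (ιF '' {p : 𝔸 | p.totalDegree ≤ d}) = ⊤) :
    (∃ W C : Submodule k 𝔸,
      W ≤ MvPolynomial.restrictTotalDegree (Fin n) k d ∧
      C ≤ MvPolynomial.restrictTotalDegree (Fin n) k d ∧
      (∀ (g : G), ∀ p ∈ W, g • p ∈ W) ∧
      (∀ (g : G), ∀ p ∈ C, g • p ∈ C) ∧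
      W ⊓ C = ⊥ ∧ W ⊔ C = MvPolynomial.restrictTotalDegree (Fin n) k d ∧
      (∃ w₀ ∈ W, LinearIndependent k (fun g : G => g • w₀) ∧
        Submodule.span k (Set.range fun g : G => g • w₀) = W)) ∧
    sInf {e : ℕ | ∃ W : Submodule k 𝔸,
        W ≤ MvPolynomial.restrictTotalDegree (Fin n) k e ∧
        (∀ (g : G), ∀ p ∈ W, g • p ∈ W) ∧
        (∃ w₀ ∈ W, LinearIndependent k (fun g : G => g • w₀) ∧
          Submodule.span k (Set.range fun g : G => g • w₀) = W)}
      ≤ sInf {e : ℕ | Submodule.span 𝕂 (ιF '' {p : 𝔸 | p.totalDegree ≤ e}) = ⊤} := by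
  refine ⟨regular_summand_aux k n G hlin hfaithful hcomp d hspan, ?_⟩
  have hne : {e : ℕ | Submodule.span 𝕂 (ιF '' {p : 𝔸 | p.totalDegree ≤ e}) = ⊤}.Nonempty :=
    ⟨d, hspan⟩
  refine Nat.sInf_le ?_
  obtain ⟨W, C, h1, -, h2, -, -, -, h3⟩ :=
    regular_summand_aux k n G hlin hfaithful hcomp _ (Nat.sInf_mem hne)
  exact ⟨W, h1, h2, h3⟩

end
end

section
/- Assume k is algebraically closed and char k does not divide |G|. If V contains the regular representation kG as a kG-submodule, then the polynomials of degree at most 1 span k(V) as a K-vector space (so D_span(G,V) = 1), and consequently k(V)^G is generated as a field extension of k by the invariant polynomials of degree at most 3 (β_field(G,V) ≤ 3). -/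
open MvPolynomial

set_option synthInstance.maxHeartbeats 1000000
set_option maxHeartbeats 1000000

section Helpers

/-- Solving an invertible linear system with coefficients in a subfield. -/
theorem aux_solve {F : Type*} [Field F] {ι : Type*} [Fintype ι] [DecidableEq ι]
    (E : Subfield F) (T : Matrix ι ι F) (hT : ∀ i j, T i j ∈ E) (hdet : T.det ≠ 0)
    (v : ι → F) (hv : ∀ i, v i ∈ E) :
    ∃ c : ι → F, (∀ i, c i ∈ E) ∧ T.mulVec c = v := by
  let T' : Matrix ι ι E := Matrix.of fun i j => ⟨T i j, hT i j⟩
  let v' : ι → E := fun i => ⟨v i, hv i⟩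
  have hTT : T = E.subtype.mapMatrix T' := by
    ext i j; rfl
  have hd' : T'.det ≠ 0 := by
    intro h
    apply hdet
    rw [hTT, ← RingHom.map_det, h, map_zero]
  have hu : IsUnit T'.det := isUnit_iff_ne_zero.mpr hd'
  let c' : ι → E := T'⁻¹.mulVec v'
  have hc' : T'.mulVec c' = v' := by
    simp only [c', Matrix.mulVec_mulVec]
    rw [Matrix.mul_nonsing_inv _ hu, Matrix.one_mulVec]
  refine ⟨fun i => (c' i : F), fun i => (c' i).2, ?_⟩
  ext i
  have := congrArg (fun w : ι → E => ((w i : E) : F)) hc'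
  simpa [Matrix.mulVec, dotProduct, T', v'] using this

variable {F : Type*} [Field F] {G : Type*} [Group G] [Fintype G] [MulSemiringAction G F]

/-- Elements whose traces against the `x g` lie in `E` are in the `E`-span of the `x g`. -/
theorem aux_span [DecidableEq G] (E : Subfield F) (x : G → F) (hx : ∀ h g : G, h • x g = x (h * g))
    (hdet : (Matrix.of fun h g : G => x (h * g)).det ≠ 0)
    (hT : ∀ a b : G, ∑ h : G, h • (x a * x b) ∈ E)
    (y : F) (hy : ∀ a : G, ∑ h : G, h • (x a * y) ∈ E) :
    ∃ c : G → F, (∀ g, c g ∈ E) ∧ y = ∑ g, c g * x g := by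
  set M : Matrix G G F := Matrix.of fun h g : G => x (h * g) with hM
  have hdet2 : (M.transpose * M).det ≠ 0 := by
    rw [Matrix.det_mul, Matrix.det_transpose]
    exact mul_ne_zero hdet hdet
  obtain ⟨c, hc, hcv⟩ := aux_solve E (M.transpose * M)
    (fun a b => by
      have := hT a b
      simp only [smul_mul', hx] at this
      simpa [Matrix.mul_apply, hM] using this) hdet2
    (M.transpose.mulVec fun h => h • y)
    (fun a => by
      have := hy a
      simp only [smul_mul', hx] at this
      simpa [Matrix.mulVec, dotProduct, hM] using this)
  refine ⟨c, hc, ?_⟩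
  rw [← Matrix.mulVec_mulVec] at hcv
  have hinj : Function.Injective M.transpose.mulVec := by
    rw [Matrix.mulVec_injective_iff_isUnit, Matrix.isUnit_iff_isUnit_det, Matrix.det_transpose]
    exact isUnit_iff_ne_zero.mpr hdet
  have h1 := congrFun (hinj hcv) 1
  simp only [Matrix.mulVec, dotProduct, hM, Matrix.of_apply, one_mul, one_smul] at h1
  rw [← h1]
  exact Finset.sum_congr rfl fun g _ => mul_comm _ _

/-- The `x g` are independent over the fixed field. -/
theorem aux_indep [DecidableEq G] (x : G → F) (hx : ∀ h g : G, h • x g = x (h * g))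
    (hdet : (Matrix.of fun h g : G => x (h * g)).det ≠ 0)
    (d : G → F) (hd : ∀ (h : G) g, h • d g = d g) (h0 : ∑ g, d g * x g = 0) : d = 0 := by
  apply Matrix.eq_zero_of_mulVec_eq_zero hdet
  ext h
  have := congrArg (fun z => h • z) h0
  simp only [Finset.smul_sum, smul_mul', hd, hx, smul_zero] at this
  simp only [Matrix.mulVec, dotProduct, Matrix.of_apply, Pi.zero_apply]
  rw [← this]
  exact Finset.sum_congr rfl fun g _ => mul_comm _ _

theorem aux_fixed_sum (y : F) : ∑ h : G, h • y ∈ FixedPoints.subfield G F := by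
  intro g
  rw [Finset.smul_sum]
  simp only [smul_smul]
  exact Fintype.sum_equiv (Equiv.mulLeft g) _ _ fun _ => rfl

/-- If `E` contains the relevant traces and `E`-span of the `x g` generates, then `K ≤ E`. -/
theorem aux_main [DecidableEq G] (E : Subfield F) (hEK : E ≤ FixedPoints.subfield G F)
    (x : G → F) (hx : ∀ h g : G, h • x g = x (h * g))
    (hdet : (Matrix.of fun h g : G => x (h * g)).det ≠ 0)
    (h1 : ∀ a : G, ∑ h : G, h • x a ∈ E)
    (h2 : ∀ a b : G, ∑ h : G, h • (x a * x b) ∈ E)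
    (h3 : ∀ a b c : G, ∑ h : G, h • (x a * (x b * x c)) ∈ E)
    (Y : Set F) (hY : ∀ y ∈ Y, ∀ a : G, ∑ h : G, h • (x a * y) ∈ E)
    (hgen : ∀ S : Subfield F, E ≤ S → Y ⊆ S → S = ⊤) :
    FixedPoints.subfield G F ≤ E := by
  set W : Submodule E F := Submodule.span E (Set.range x) with hW
  have key : ∀ y : F, (∀ a : G, ∑ h : G, h • (x a * y) ∈ E) → y ∈ W := by
    intro y hy
    obtain ⟨c, hc, rfl⟩ := aux_span E x hx hdet h2 y hy
    refine Submodule.sum_mem _ fun g _ => ?_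
    exact W.smul_mem (⟨c g, hc g⟩ : E) (Submodule.subset_span ⟨g, rfl⟩)
  have hone : (1 : F) ∈ W := key 1 fun a => by simpa using h1 a
  have hmul : ∀ u v : F, u ∈ W → v ∈ W → u * v ∈ W := by
    intro u v hu hv
    have hWW : W * W ≤ W := by
      rw [hW, Submodule.span_mul_span, Submodule.span_le]
      rintro _ ⟨_, ⟨a, rfl⟩, _, ⟨b, rfl⟩, rfl⟩
      exact key _ fun c => h3 c a b
    exact hWW (Submodule.mul_mem_mul hu hv)
  let A : Subalgebra E F := W.toSubalgebra hone hmul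
  have hfg : A.toSubmodule.FG := by
    have : A.toSubmodule = W := by ext; rfl
    rw [this]
    exact Submodule.fg_span (Set.finite_range x)
  have hinv : ∀ u ∈ A, u⁻¹ ∈ A := by
    intro u hu
    have : IsIntegral E u := IsIntegral.of_mem_of_fg A hfg u hu
    exact A.inv_mem_of_algebraic (x := ⟨u, hu⟩) (by simpa using this.isAlgebraic)
  let S : Subfield F := { A with
    neg_mem' := fun {u} hu => A.neg_mem hu
    inv_mem' := hinv }
  have hS : S = ⊤ := by
    apply hgen
    · intro e he
      exact A.algebraMap_mem ⟨e, he⟩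
    · intro y hy
      exact key y (hY y hy)
  have hall : ∀ y : F, y ∈ W := by
    intro y
    have : y ∈ S := hS ▸ Subfield.mem_top y
    exact this
  intro c hc
  have := hall (c * x 1)
  rw [hW, Submodule.mem_span_range_iff_exists_fun] at this
  obtain ⟨e, he⟩ := this
  have hz := aux_indep x hx hdet (fun g => (e g : F) - if g = 1 then c else 0)
    (fun h g => by
      have he' : h • (e g : F) = e g := hEK (e g).2 h
      have hc' : h • c = c := hc h
      split_ifs <;> simp [smul_sub, he', hc'])
    (by
      simp only [sub_mul, Finset.sum_sub_distrib, ite_mul, zero_mul, Finset.sum_ite_eq',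
        Finset.mem_univ, if_true]
      rw [← he, sub_eq_zero]
      rfl)
  have := congrFun hz 1
  simp only [if_true, Pi.zero_apply, sub_eq_zero] at this
  rw [← this]
  exact (e 1).2

end Helpers

section HelpersPoly

/-- Nonvanishing of the group determinant. -/
theorem aux_det {k : Type*} [Field k] {n : ℕ} {G : Type*} [Group G] [Fintype G] [DecidableEq G]
    (x : G → MvPolynomial (Fin n) k) (hhom : ∀ g, (x g).IsHomogeneous 1)
    (hli : LinearIndependent k x) :
    (Matrix.of fun h g : G => x (h * g)).det ≠ 0 := by
  obtain ⟨L, hL⟩ : ∃ L : MvPolynomial (Fin n) k →ₗ[k] k,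
      ∀ g, L (x g) = if g = 1 then 1 else 0 := by
    obtain ⟨L, hL⟩ := LinearMap.exists_extend
      ((Finsupp.lapply (1 : G)).comp hli.repr : Submodule.span k (Set.range x) →ₗ[k] k)
    refine ⟨L, fun g => ?_⟩
    have := congrArg (fun f => f ⟨x g, Submodule.subset_span ⟨g, rfl⟩⟩) hL
    simp only [LinearMap.comp_apply, Submodule.subtype_apply] at this
    rw [this, hli.repr_eq_single g _ rfl]
    simp [Finsupp.single_apply]
  let φ : MvPolynomial (Fin n) k →ₐ[k] k := aeval fun i => L (X i)
  have hφ : ∀ p : MvPolynomial (Fin n) k, p.IsHomogeneous 1 → φ p = L p := by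
    intro p hp
    have hp' : p ∈ Submodule.span k (Set.range (X : Fin n → MvPolynomial (Fin n) k)) := by
      rw [← homogeneousSubmodule_one_eq_span_X]; exact hp
    have := LinearMap.eqOn_span (f := φ.toLinearMap) (g := L) (s := Set.range X) (by
      rintro _ ⟨i, rfl⟩
      simp [φ]) hp'
    simpa using this
  intro h0
  have h1 := congrArg φ h0
  rw [AlgHom.map_det, map_zero] at h1
  have h2 : φ.mapMatrix (Matrix.of fun h g : G => x (h * g)) =
      (1 : Matrix G G k).submatrix (Equiv.inv G) id := by
    ext h g
    simp only [AlgHom.mapMatrix_apply, Matrix.map_apply, Matrix.of_apply, hφ _ (hhom _), hL,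
      Matrix.submatrix_apply, Matrix.one_apply, Equiv.inv_apply, id]
    congr 1
    rw [mul_eq_one_iff_inv_eq]
  rw [h2, Matrix.det_permute, Matrix.det_one, mul_one] at h1
  have : ((Equiv.Perm.sign (Equiv.inv G) : ℤ) : k) ≠ 0 := by
    rcases Int.units_eq_one_or (Equiv.Perm.sign (Equiv.inv G)) with h | h <;> simp [h]
  exact this h1

end HelpersPoly

section

variable (k : Type*) [Field k] (n : ℕ) (G : Type*) [Group G] [Fintype G]
  [MulSemiringAction G (MvPolynomial (Fin n) k)]
  [MulSemiringAction G (FractionRing (MvPolynomial (Fin n) k))]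

local notation "𝔸" => MvPolynomial (Fin n) k
local notation "𝔽" => FractionRing (MvPolynomial (Fin n) k)
local notation "𝕂" => FixedPoints.subfield G (FractionRing (MvPolynomial (Fin n) k))
local notation "ιF" =>
  algebraMap (MvPolynomial (Fin n) k) (FractionRing (MvPolynomial (Fin n) k))

/-- **Example/Theorem (representations containing the regular representation; Edidin–Katz).**
Assume `k` is algebraically closed and `char k ∤ |G|`.  If `V` contains the regular
representation `kG` as a `kG`-submodule (equivalently, the linear forms `k[V]_1` contain a
normal-basis element `w₀`, whose `G`-orbit is `k`-linearly independent), then the polynomials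
of degree at most `1` span `k(V)` as a `K = k(V)^G`-vector space (so `D_span(G,V) = 1`), and
consequently `k(V)^G` is generated as a field extension of `k` by the invariant polynomials
of degree at most `3` (`β_field(G,V) ≤ 3`). -/
theorem regular_in_V_implies_field_noether_le_three
    [IsAlgClosed k]
    [SMulCommClass G k (MvPolynomial (Fin n) k)]
    (hlin : ∀ (g : G) (i : Fin n), ((g • (X i : 𝔸)).IsHomogeneous 1))
    (hfaithful : ∀ g : G, (∀ p : 𝔸, g • p = p) → g = 1)
    (hcomp : ∀ (g : G) (p : 𝔸), g • (ιF p) = ιF (g • p))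
    (hchar : (Fintype.card G : k) ≠ 0)
    -- `V` contains the regular representation
    (hreg : ∃ w₀ : 𝔸, w₀.IsHomogeneous 1 ∧ LinearIndependent k (fun g : G => g • w₀)) :
    Submodule.span 𝕂 (ιF '' {p : 𝔸 | p.totalDegree ≤ 1}) = ⊤ ∧
    sInf {e : ℕ | Submodule.span 𝕂 (ιF '' {p : 𝔸 | p.totalDegree ≤ e}) = ⊤} ≤ 1 ∧
    Subfield.closure
        (Set.range (algebraMap k 𝔽)
          ∪ (ιF '' {p : 𝔸 | p.totalDegree ≤ 3 ∧ ∀ g : G, g • p = p})) = 𝕂 ∧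
    sInf {e : ℕ | Subfield.closure
        (Set.range (algebraMap k 𝔽)
          ∪ (ιF '' {p : 𝔸 | p.totalDegree ≤ e ∧ ∀ g : G, g • p = p})) = 𝕂} ≤ 3 := by
  classical
  obtain ⟨w₀, hw₀, hli⟩ := hreg
  -- the action is by `k`-algebra maps
  have hact : ∀ (g : G) (p : 𝔸), g • p = aeval (fun i => g • (X i : 𝔸)) p := by
    intro g p
    induction p using MvPolynomial.induction_on with
    | C a =>
      rw [aeval_C, algebraMap_eq, ← mul_one (C a), ← smul_eq_C_mul, smul_comm, smul_one]
    | add p q hp hq => rw [smul_add, map_add, hp, hq]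
    | mul_X p i hp => rw [smul_mul', map_mul, hp, aeval_X]
  have hactC : ∀ (g : G) (a : k), g • (C a : 𝔸) = C a := by
    intro g a
    rw [hact, aeval_C, algebraMap_eq]
  have hhom : ∀ (g : G) (p : 𝔸), p.IsHomogeneous 1 → (g • p).IsHomogeneous 1 := by
    intro g p hp
    rw [hact]
    simpa using hp.aeval _ (hlin g)
  have hdeg : ∀ (g : G) (p : 𝔸), p.IsHomogeneous 1 → (g • p).totalDegree ≤ 1 :=
    fun g p hp => (hhom g p hp).totalDegree_le
  have hxhom : ∀ g : G, (g • w₀).IsHomogeneous 1 := fun g => hhom g w₀ hw₀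
  let x : G → 𝔽 := fun g => ιF (g • w₀)
  have hx : ∀ h g : G, h • x g = x (h * g) := by
    intro h g
    simp only [x, hcomp, smul_smul]
  have hdet : (Matrix.of fun h g : G => x (h * g)).det ≠ 0 := by
    have h0 := aux_det (fun g : G => g • w₀) hxhom hli
    have h1 : (Matrix.of fun h g : G => x (h * g)) =
        (ιF).mapMatrix (Matrix.of fun h g : G => (h * g) • w₀) := by
      ext h g; rfl
    rw [h1, ← RingHom.map_det]
    exact (map_ne_zero_iff _ (IsFractionRing.injective 𝔸 𝔽)).mpr h0
  have part1 : Submodule.span 𝕂 (ιF '' {p : 𝔸 | p.totalDegree ≤ 1}) = ⊤ := by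
    rw [eq_top_iff]
    intro y _
    obtain ⟨c, hc, rfl⟩ := aux_span (𝕂) x hx hdet (fun a b => aux_fixed_sum _) y
      (fun a => aux_fixed_sum _)
    refine Submodule.sum_mem _ fun g _ => ?_
    exact Submodule.smul_mem _ (⟨c g, hc g⟩ : 𝕂)
      (Submodule.subset_span ⟨g • w₀, (hxhom g).totalDegree_le, rfl⟩)
  have part2 : Subfield.closure
        (Set.range (algebraMap k 𝔽)
          ∪ (ιF '' {p : 𝔸 | p.totalDegree ≤ 3 ∧ ∀ g : G, g • p = p})) = 𝕂 := by
    set E : Subfield 𝔽 := Subfield.closure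
        (Set.range (algebraMap k 𝔽)
          ∪ (ιF '' {p : 𝔸 | p.totalDegree ≤ 3 ∧ ∀ g : G, g • p = p})) with hE
    have hEK : E ≤ 𝕂 := by
      rw [hE, Subfield.closure_le]
      rintro _ (⟨a, rfl⟩ | ⟨p, ⟨_, hp⟩, rfl⟩) g
      · rw [IsScalarTower.algebraMap_apply k 𝔸 𝔽, hcomp, algebraMap_eq, hactC]
      · rw [hcomp, hp]
    have htr : ∀ p : 𝔸, (∀ h : G, (h • p).totalDegree ≤ 3) → ∑ h : G, h • ιF p ∈ E := by
      intro p hp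
      have : ∑ h : G, h • ιF p = ιF (∑ h : G, h • p) := by
        rw [map_sum]
        exact Finset.sum_congr rfl fun h _ => hcomp h p
      rw [this]
      refine Subfield.subset_closure (Or.inr ⟨_, ⟨?_, ?_⟩, rfl⟩)
      · exact totalDegree_finsetSum_le fun h _ => hp h
      · intro g
        rw [Finset.smul_sum]
        simp only [smul_smul]
        exact Fintype.sum_equiv (Equiv.mulLeft g) _ _ fun _ => rfl
    have d1 : ∀ (p : 𝔸), p.IsHomogeneous 1 → ∀ h : G, (h • p).totalDegree ≤ 1 :=
      fun p hp h => hdeg h p hp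
    have d2 : ∀ (p q : 𝔸), p.IsHomogeneous 1 → q.IsHomogeneous 1 →
        ∀ h : G, (h • (p * q)).totalDegree ≤ 2 := by
      intro p q hp hq h
      rw [smul_mul']
      exact (totalDegree_mul _ _).trans (add_le_add (d1 p hp h) (d1 q hq h))
    refine le_antisymm hEK (aux_main E hEK x hx hdet ?_ ?_ ?_ (Set.range fun i => ιF (X i)) ?_ ?_)
    · intro a
      exact htr _ fun h => (d1 _ (hxhom a) h).trans (by norm_num)
    · intro a b
      simp only [x, ← map_mul]
      exact htr _ fun h => (d2 _ _ (hxhom a) (hxhom b) h).trans (by norm_num)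
    · intro a b c
      simp only [x, ← map_mul]
      refine htr _ fun h => ?_
      rw [smul_mul']
      exact (totalDegree_mul _ _).trans
        (add_le_add (d1 _ (hxhom a) h) (d2 _ _ (hxhom b) (hxhom c) h))
    · rintro _ ⟨i, rfl⟩ a
      simp only [x, ← map_mul]
      exact htr _ fun h => (d2 _ _ (hxhom a) (isHomogeneous_X k i) h).trans (by norm_num)
    · intro S hES hYS
      have hA : ∀ p : 𝔸, ιF p ∈ S := by
        intro p
        induction p using MvPolynomial.induction_on with
        | C a =>
          refine hES (Subfield.subset_closure (Or.inl ⟨a, ?_⟩))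
          rw [IsScalarTower.algebraMap_apply k 𝔸 𝔽, algebraMap_eq]
        | add p q hp hq => rw [map_add]; exact S.add_mem hp hq
        | mul_X p i hp => rw [map_mul]; exact S.mul_mem hp (hYS ⟨i, rfl⟩)
      rw [eq_top_iff]
      intro z _
      obtain ⟨p, q, _, rfl⟩ := IsFractionRing.div_surjective (A := 𝔸) z
      exact S.div_mem (hA p) (hA q)
  exact ⟨part1, Nat.sInf_le part1, part2, Nat.sInf_le part2⟩

end
end

section
/- Let n be an odd natural number, ζ ∈ ℂ a primitive n-th root of unity, and let the cyclic group G = C_n = ⟨g⟩ of order n act on V = ℂ² so that on the coordinate functions x, y one has g·x = ζ^{-1}x and g·y = ζy. Then: (a) the monomials x^{(n-1)/2}, …, x, 1, y, …, y^{(n-1)/2} form a basis of ℂ(x,y) over ℂ(x,y)^G, so D_span(G,V) = (n−1)/2; (b) ℂ(x,y)^G is generated as a field extension of ℂ by x^n and xy, but is not generated by the invariant polynomials of degree at most n−1; hence β_field(G,V) = n = 2·D_span(G,V) + 1. -/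
open MvPolynomial

set_option synthInstance.maxHeartbeats 1000000
set_option maxHeartbeats 1000000

theorem LI_aux {F G I : Type*} [Field F] [Group G] [MulSemiringAction G F] (g : G)
   (v : I → F) (c : I → FixedPoints.subfield G F) (hc : Function.Injective c)
   (hv : ∀ i, v i ≠ 0) (h : ∀ i, g • v i = (c i : F) * v i) : 
   LinearIndependent (FixedPoints.subfield G F) v := by
  let f : F →ₗ[FixedPoints.subfield G F] F := 
   { toFun := fun a => g • a, map_add' := smul_add g, map_smul' := fun r a => smul_comm g r a }
  refine Module.End.eigenvectors_linearIndependent' f c hc v fun i => ⟨?_, hv i⟩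
  rw [Module.End.mem_eigenspace_iff]
  exact h i

theorem span_aux {F G I : Type*} [Field F] [Group G] [Fintype G] [MulSemiringAction G F] [Fintype I]
   (v : I → F) (hc : Fintype.card I = Fintype.card G) 
   (h : LinearIndependent (FixedPoints.subfield G F) v) :
   Submodule.span (FixedPoints.subfield G F) (Set.range v) = ⊤ := by
  apply h.span_eq_top_of_card_eq_finrank'
  apply le_antisymm h.fintype_card_le_finrank
  rw [hc]; exact FixedPoints.finrank_le_card G F

theorem coeff_aux {G : Type*} [Group G] [MulSemiringAction G (MvPolynomial (Fin 2) ℂ)]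
    [SMulCommClass G ℂ (MvPolynomial (Fin 2) ℂ)] (ζ : ℂ) (g : G)
    (hgx : g • (X 0 : MvPolynomial (Fin 2) ℂ) = MvPolynomial.C ζ⁻¹ * X 0)
    (hgy : g • (X 1 : MvPolynomial (Fin 2) ℂ) = MvPolynomial.C ζ * X 1)
    (p : MvPolynomial (Fin 2) ℂ) (s : Fin 2 →₀ ℕ) :
    coeff s (g • p) = ζ⁻¹ ^ (s 0) * ζ ^ (s 1) * coeff s p := by
  induction p using MvPolynomial.induction_on' with
  | add p q hp hq => rw [smul_add, coeff_add, coeff_add, hp, hq, mul_add]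
  | monomial u a => 
    have : g • monomial u a = monomial u (ζ⁻¹ ^ (u 0) * ζ ^ (u 1) * a) := by
      have hC : ∀ c : ℂ, g • (C c : MvPolynomial (Fin 2) ℂ) = C c := fun c => by
        rw [← mul_one (C c), ← smul_eq_C_mul, smul_comm, smul_one]
      rw [monomial_eq, monomial_eq, Finsupp.prod_fintype _ _ (by simp), Fin.prod_univ_two, 
        smul_mul', smul_mul', smul_pow', smul_pow', hgx, hgy, hC]
      simp only [C_mul, C_pow]
      ring
    rw [this, coeff_monomial, coeff_monomial]
    split_ifs with h
    · rw [h]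
    · simp

theorem inv_aux {G : Type*} [Group G] [MulSemiringAction G (MvPolynomial (Fin 2) ℂ)]
    [SMulCommClass G ℂ (MvPolynomial (Fin 2) ℂ)] {n : ℕ} {ζ : ℂ} (hζ : IsPrimitiveRoot ζ n) (hn : n ≠ 0) (g : G)
    (hgx : g • (X 0 : MvPolynomial (Fin 2) ℂ) = MvPolynomial.C ζ⁻¹ * X 0)
    (hgy : g • (X 1 : MvPolynomial (Fin 2) ℂ) = MvPolynomial.C ζ * X 1)
    (p : MvPolynomial (Fin 2) ℂ) (hp : g • p = p) (s : Fin 2 →₀ ℕ) (hs : coeff s p ≠ 0) :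
    (n : ℤ) ∣ (s 1 : ℤ) - s 0 := by
  have h := coeff_aux ζ g hgx hgy p s
  rw [hp] at h
  have h1 : ζ⁻¹ ^ (s 0) * ζ ^ (s 1) = 1 := by
    apply mul_right_cancel₀ hs; rw [← h, one_mul]
  have h0 := hζ.ne_zero hn
  rw [← hζ.zpow_eq_one_iff_dvd, zpow_sub₀ h0, zpow_natCast, zpow_natCast, ← h1, inv_pow, div_eq_mul_inv, mul_comm]

theorem mem_aux {F : Type*} [Field F] [Algebra (MvPolynomial (Fin 2) ℂ) F]
    (L : Subfield F) (hC : ∀ c, algebraMap _ F (C c : MvPolynomial (Fin 2) ℂ) ∈ L)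
    (p : MvPolynomial (Fin 2) ℂ) (h : ∀ s, coeff s p ≠ 0 → 
      algebraMap _ F (X 0 : MvPolynomial (Fin 2) ℂ) ^ (s 0) * algebraMap _ F (X 1 : MvPolynomial (Fin 2) ℂ) ^ (s 1) ∈ L) :
   algebraMap _ F p ∈ L := by
  rw [p.as_sum, map_sum]
  refine Subfield.sum_mem _ fun s hs => ?_
  rw [monomial_eq, Finsupp.prod_fintype _ _ (by simp), Fin.prod_univ_two, map_mul, map_mul, map_pow, map_pow]
  exact L.mul_mem (hC _) (h s (mem_support_iff.1 hs))

-- monomials with n ∣ b - a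
theorem mono_aux {F : Type*} [Field F] (x y : F) (hx : x ≠ 0) (n : ℕ) (L : Subfield F) (h1 : x ^ n ∈ L) (h2 : x * y ∈ L) (a b : ℕ)
   (h : (n : ℤ) ∣ (b : ℤ) - a) : x ^ a * y ^ b ∈ L := by
  obtain ⟨k, hk⟩ := h
  have : x ^ a * y ^ b = (x * y) ^ b * (x ^ n) ^ (- k) := by
    rw [mul_pow, ← zpow_natCast x n, ← zpow_mul, mul_neg, ← hk, neg_sub, mul_right_comm, ← zpow_natCast x b, ← zpow_add₀ hx]
    congr 1
    rw [← zpow_natCast x a]; congr 1; ring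
  rw [this]
  exact L.mul_mem (L.pow_mem h2 _) (L.zpow_mem h1 _)

-- fraction invariants
theorem frac_aux {A F G : Type*} [CommRing A] [IsDomain A] [Field F] [Algebra A F] [IsFractionRing A F] [Group G] [Fintype G]
   [MulSemiringAction G A] [MulSemiringAction G F] (hcomp : ∀ (g' : G) (p : A), g' • (algebraMap A F p) = algebraMap A F (g' • p))
   (f : F) (hf : ∀ g : G, g • f = f) : ∃ p q : A, (∀ g : G, g • p = p) ∧ (∀ g : G, g • q = q) ∧ f = algebraMap A F p / algebraMap A F q := by
  obtain ⟨p, q, hq, rfl⟩ := IsFractionRing.div_surjective (A := A) f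
  have hq0 := nonZeroDivisors.ne_zero hq
  have hinj := IsFractionRing.injective A F
  classical
  let N : A := ∏ g : G, g • q
  have hN : ∀ g : G, g • N = N := fun g => by
    simp only [N, Finset.smul_prod', smul_smul]
    exact Fintype.prod_equiv (Equiv.mulLeft g) _ _ (fun _ => rfl)
  have hN0 : N ≠ 0 := Finset.prod_ne_zero_iff.2 fun g _ => by
    rw [Ne, smul_eq_zero_iff_eq]; exact hq0
  have hqN : q ∣ N := by
    have := Finset.dvd_prod_of_mem (fun g : G => g • q) (Finset.mem_univ 1)
    simpa using this
  obtain ⟨r, hr⟩ := hqN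
  have hr0 : r ≠ 0 := by rintro rfl; simp [hr] at hN0
  have e : algebraMap A F p / algebraMap A F q = algebraMap A F (p * r) / algebraMap A F N := by
    rw [hr, map_mul, map_mul, mul_div_mul_right]
    exact fun h => hr0 (hinj (by simpa using h))
  refine ⟨p * r, N, fun g => ?_, hN, e⟩
  have hN0' : algebraMap A F N ≠ 0 := fun h => hN0 (hinj (by simpa using h))
  apply hinj
  rw [e] at hf
  rw [← hcomp]
  have e2 : algebraMap A F (p * r) = (algebraMap A F (p * r) / algebraMap A F N) * algebraMap A F N := by
    rw [div_mul_cancel₀ _ hN0']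
  conv_lhs => rw [e2, smul_mul', hf, hcomp, hN, ← e2]

-- the twisting automorphism
theorem twist_aux {F : Type*} [Field F] [Algebra (MvPolynomial (Fin 2) ℂ) F] [IsFractionRing (MvPolynomial (Fin 2) ℂ) F] :
   ∃ φ : F →+* F, (∀ c, φ (algebraMap _ F (C c : MvPolynomial (Fin 2) ℂ)) = algebraMap _ F (C c : MvPolynomial (Fin 2) ℂ)) ∧
     φ (algebraMap _ F (X 0 : MvPolynomial (Fin 2) ℂ)) = 2 * algebraMap _ F (X 0 : MvPolynomial (Fin 2) ℂ) ∧
     φ (algebraMap _ F (X 1 : MvPolynomial (Fin 2) ℂ)) = algebraMap _ F (C 2⁻¹ * X 1 : MvPolynomial (Fin 2) ℂ) := by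
  let f : MvPolynomial (Fin 2) ℂ →ₐ[ℂ] MvPolynomial (Fin 2) ℂ := aeval ![C 2 * X 0, C 2⁻¹ * X 1]
  let f' : MvPolynomial (Fin 2) ℂ →ₐ[ℂ] MvPolynomial (Fin 2) ℂ := aeval ![C 2⁻¹ * X 0, C 2 * X 1]
  have hff : f'.comp f = AlgHom.id _ _ := by
    apply MvPolynomial.algHom_ext
    intro i
    fin_cases i
    · simp [f, f', ← algebraMap_eq]
      simp [← mul_assoc, ← C_mul]
    · simp [f, f', ← algebraMap_eq]
      simp [← mul_assoc, ← C_mul]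
  have hf : Function.Injective f := Function.LeftInverse.injective (g := f') (fun p => DFunLike.congr_fun hff p)
  have hi : Function.Injective ((algebraMap (MvPolynomial (Fin 2) ℂ) F).comp f.toRingHom) := 
    (IsFractionRing.injective _ F).comp hf
  refine ⟨IsFractionRing.lift hi, fun c => ?_, ?_, ?_⟩
  · rw [IsFractionRing.lift_algebraMap]
    exact congrArg (algebraMap _ F) (f.commutes c)
  · rw [IsFractionRing.lift_algebraMap]
    simp [f]
    exact map_ofNat ((algebraMap (MvPolynomial (Fin 2) ℂ) F).comp C) 2
  · rw [IsFractionRing.lift_algebraMap]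
    simp [f]

theorem span_deg_aux {F : Type*} [Field F] [Algebra (MvPolynomial (Fin 2) ℂ) F] (K : Subfield F)
    (hC : ∀ c, algebraMap _ F (C c : MvPolynomial (Fin 2) ℂ) ∈ K)
    (hxy : algebraMap _ F (X 0 * X 1 : MvPolynomial (Fin 2) ℂ) ∈ K) (e : ℕ) (S : Submodule K F)
    (hx : ∀ i ≤ e, algebraMap _ F (X 0 ^ i : MvPolynomial (Fin 2) ℂ) ∈ S)
    (hy : ∀ i ≤ e, algebraMap _ F (X 1 ^ i : MvPolynomial (Fin 2) ℂ) ∈ S)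
    (p : MvPolynomial (Fin 2) ℂ) (hp : p.totalDegree ≤ e) : algebraMap _ F p ∈ S := by
  rw [p.as_sum, map_sum]
  refine Submodule.sum_mem _ fun s hs => ?_
  have hs' : s 0 + s 1 ≤ e := by
    have := le_totalDegree hs
    rw [Finsupp.sum_fintype _ _ (by simp), Fin.sum_univ_two] at this
    omega
  have key : ∀ k ∈ K, ∀ m ∈ S, k * m ∈ S := fun k hk m hm => S.smul_mem (⟨k, hk⟩ : K) hm
  rw [monomial_eq, Finsupp.prod_fintype _ _ (by simp), Fin.prod_univ_two, map_mul]
  apply key _ (hC _)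
  rcases le_total (s 0) (s 1) with h | h
  · obtain ⟨d, hd⟩ := Nat.exists_eq_add_of_le h
    rw [hd, pow_add, ← mul_assoc, ← mul_pow, map_mul, map_pow]
    exact key _ (K.pow_mem hxy _) _ (hy d (by omega))
  · obtain ⟨d, hd⟩ := Nat.exists_eq_add_of_le h
    rw [hd, pow_add, mul_right_comm, ← mul_pow, map_mul, map_pow]
    exact key _ (K.pow_mem hxy _) _ (hx d (by omega))

theorem not_mem_aux {F : Type*} [Field F] [Algebra (MvPolynomial (Fin 2) ℂ) F]
    [IsFractionRing (MvPolynomial (Fin 2) ℂ) F] {n : ℕ} (hn : n ≠ 0) (T : Set F)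
    (hT : ∀ L : Subfield F, (∀ c, algebraMap _ F (C c : MvPolynomial (Fin 2) ℂ) ∈ L) →
      algebraMap _ F (X 0 * X 1 : MvPolynomial (Fin 2) ℂ) ∈ L → T ⊆ L) :
    algebraMap _ F (X 0 ^ n : MvPolynomial (Fin 2) ℂ) ∉ Subfield.closure T := by
  obtain ⟨φ, h1, h2, h3⟩ := twist_aux (F := F)
  have hinj := IsFractionRing.injective (MvPolynomial (Fin 2) ℂ) F
  have h22 : algebraMap _ F (C 2 : MvPolynomial (Fin 2) ℂ) = 2 :=
    map_ofNat ((algebraMap (MvPolynomial (Fin 2) ℂ) F).comp C) 2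
  have := Subfield.closure_le.2 (hT (RingHom.eqLocusField φ (RingHom.id F)) h1 (by
    change φ _ = _
    rw [map_mul, map_mul, h2, h3, ← h22, ← map_mul, ← map_mul]
    change _ = algebraMap _ F _ * algebraMap _ F _
    rw [← map_mul]
    congr 1
    rw [mul_mul_mul_comm, ← C_mul]
    simp))
  intro hm
  have hm := this hm
  change φ _ = _ at hm
  rw [map_pow, map_pow, h2, ← h22, ← map_mul, ← map_pow] at hm
  change _ = algebraMap _ F _ ^ n at hm
  rw [← map_pow] at hm
  have h := hinj hm
  have h := congrArg (eval (fun _ => (1 : ℂ))) h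
  simp only [map_pow, map_mul, eval_C, eval_X, mul_one, one_pow] at h
  have h' : (2 : ℕ) ^ n = 1 := by exact_mod_cast h
  exact hn (by simpa using h')

theorem deg_lt_aux {G : Type*} [Group G] [MulSemiringAction G (MvPolynomial (Fin 2) ℂ)]
    [SMulCommClass G ℂ (MvPolynomial (Fin 2) ℂ)] {n : ℕ} {ζ : ℂ} (hζ : IsPrimitiveRoot ζ n)
    (hn : n ≠ 0) (g : G)
    (hgx : g • (X 0 : MvPolynomial (Fin 2) ℂ) = MvPolynomial.C ζ⁻¹ * X 0)
    (hgy : g • (X 1 : MvPolynomial (Fin 2) ℂ) = MvPolynomial.C ζ * X 1)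
    {F : Type*} [Field F] [Algebra (MvPolynomial (Fin 2) ℂ) F] (L : Subfield F)
    (hC : ∀ c, algebraMap _ F (C c : MvPolynomial (Fin 2) ℂ) ∈ L)
    (hxy : algebraMap _ F (X 0 * X 1 : MvPolynomial (Fin 2) ℂ) ∈ L)
    (p : MvPolynomial (Fin 2) ℂ) (hp : g • p = p) (hd : p.totalDegree < n) :
    algebraMap _ F p ∈ L := by
  apply mem_aux L hC
  intro s hs
  have h := inv_aux hζ hn g hgx hgy p hp s hs
  have h2 := le_totalDegree (mem_support_iff.2 hs)
  rw [Finsupp.sum_fintype _ _ (by simp), Fin.sum_univ_two] at h2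
  have h3 : (s 1 : ℤ) - s 0 = 0 := Int.eq_zero_of_abs_lt_dvd h (by rw [abs_lt]; omega)
  have h4 : s 1 = s 0 := by omega
  rw [h4, ← mul_pow, ← map_mul]
  exact L.pow_mem hxy _

theorem gen_aux {G : Type*} [Group G] [Fintype G] [MulSemiringAction G (MvPolynomial (Fin 2) ℂ)]
    [SMulCommClass G ℂ (MvPolynomial (Fin 2) ℂ)] {n : ℕ} {ζ : ℂ} (hζ : IsPrimitiveRoot ζ n)
    (hn : n ≠ 0) (g : G)
    (hgx : g • (X 0 : MvPolynomial (Fin 2) ℂ) = MvPolynomial.C ζ⁻¹ * X 0)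
    (hgy : g • (X 1 : MvPolynomial (Fin 2) ℂ) = MvPolynomial.C ζ * X 1)
    {F : Type*} [Field F] [Algebra (MvPolynomial (Fin 2) ℂ) F]
    [IsFractionRing (MvPolynomial (Fin 2) ℂ) F] [MulSemiringAction G F]
    (hcomp : ∀ (g' : G) (p : MvPolynomial (Fin 2) ℂ),
      g' • (algebraMap _ F p) = algebraMap _ F (g' • p)) (L : Subfield F)
    (hC : ∀ c, algebraMap _ F (C c : MvPolynomial (Fin 2) ℂ) ∈ L)
    (hx : algebraMap _ F (X 0 ^ n : MvPolynomial (Fin 2) ℂ) ∈ L)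
    (hxy : algebraMap _ F (X 0 * X 1 : MvPolynomial (Fin 2) ℂ) ∈ L) :
    FixedPoints.subfield G F ≤ L := by
  intro f hf
  obtain ⟨p, q, hp, hq, rfl⟩ := frac_aux (A := MvPolynomial (Fin 2) ℂ) hcomp f hf
  have hinj := IsFractionRing.injective (MvPolynomial (Fin 2) ℂ) F
  have key : ∀ p : MvPolynomial (Fin 2) ℂ, g • p = p → algebraMap _ F p ∈ L := fun p hp => by
    apply mem_aux L hC
    intro s hs
    rw [map_pow] at hx
    rw [map_mul] at hxy
    refine mono_aux _ _ ?_ n L hx hxy _ _ (inv_aux hζ hn g hgx hgy p hp s hs)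
    intro h0
    exact X_ne_zero (R := ℂ) (0 : Fin 2) (hinj (by simpa using h0))
  exact L.div_mem (key p (hp g)) (key q (hq g))

section

variable (n : ℕ) (G : Type*) [Group G] [Fintype G]
  [MulSemiringAction G (MvPolynomial (Fin 2) ℂ)]
  [MulSemiringAction G (FractionRing (MvPolynomial (Fin 2) ℂ))]

local notation "𝔸" => MvPolynomial (Fin 2) ℂ
local notation "𝔽" => FractionRing (MvPolynomial (Fin 2) ℂ)
local notation "𝕂" => FixedPoints.subfield G (FractionRing (MvPolynomial (Fin 2) ℂ))
local notation "ιF" =>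
  algebraMap (MvPolynomial (Fin 2) ℂ) (FractionRing (MvPolynomial (Fin 2) ℂ))

/-- **Example (sharpness: a cyclic group with `β_field = 2·D_span + 1`).** Let `n` be odd,
`ζ ∈ ℂ` a primitive `n`-th root of unity, and let the cyclic group `G = Cₙ = ⟨g⟩` of order
`n` act on `V = ℂ²` so that on the coordinate functions `x = X 0`, `y = X 1` one has
`g·x = ζ⁻¹ x` and `g·y = ζ y`.  Then:
(a) the monomials `x^{(n-1)/2}, …, x, 1, y, …, y^{(n-1)/2}` form a basis of `ℂ(x,y)` over
`ℂ(x,y)^G`, so `D_span(G,V) = (n-1)/2`;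
(b) `ℂ(x,y)^G` is generated as a field extension of `ℂ` by `x^n` and `xy`, but not by
the invariant polynomials of degree at most `n-1`; hence
`β_field(G,V) = n = 2·D_span(G,V) + 1`. -/
theorem cyclic_example_betaField_eq_two_mul_Dspan_add_one
    [SMulCommClass G ℂ (MvPolynomial (Fin 2) ℂ)]
    (hodd : Odd n) (ζ : ℂ) (hζ : IsPrimitiveRoot ζ n)
    (hcard : Fintype.card G = n)
    (g : G) (hgen : ∀ x : G, x ∈ Subgroup.zpowers g)
    (hgx : g • (X 0 : 𝔸) = MvPolynomial.C ζ⁻¹ * X 0)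
    (hgy : g • (X 1 : 𝔸) = MvPolynomial.C ζ * X 1)
    (hcomp : ∀ (g' : G) (p : 𝔸), g' • (ιF p) = ιF (g' • p)) :
    -- (a) the monomials `x^a` (`a ≤ (n-1)/2`) and `y^b` (`b ≤ (n-1)/2`) form a `K`-basis
    (LinearIndependent 𝕂 (fun m : {m : ℤ // m.natAbs ≤ (n - 1) / 2} =>
        ιF (if 0 ≤ m.1 then (X 1 : 𝔸) ^ m.1.toNat else (X 0 : 𝔸) ^ (-m.1).toNat))) ∧
    Submodule.span 𝕂 (Set.range (fun m : {m : ℤ // m.natAbs ≤ (n - 1) / 2} =>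
        ιF (if 0 ≤ m.1 then (X 1 : 𝔸) ^ m.1.toNat else (X 0 : 𝔸) ^ (-m.1).toNat))) = ⊤ ∧
    sInf {e : ℕ | Submodule.span 𝕂 (ιF '' {p : 𝔸 | p.totalDegree ≤ e}) = ⊤}
      = (n - 1) / 2 ∧
    -- (b) the invariant field is generated by `x^n` and `xy`, …
    Subfield.closure
        (Set.range (algebraMap ℂ 𝔽) ∪ {ιF ((X 0 : 𝔸) ^ n), ιF ((X 0 : 𝔸) * X 1)}) = 𝕂 ∧
    -- … but not by the invariant polynomials of degree at most `n - 1`, …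
    Subfield.closure
        (Set.range (algebraMap ℂ 𝔽)
          ∪ (ιF '' {p : 𝔸 | p.totalDegree ≤ n - 1 ∧ ∀ g' : G, g' • p = p})) ≠ 𝕂 ∧
    -- … hence `β_field(G,V) = n`
    sInf {e : ℕ | Subfield.closure
        (Set.range (algebraMap ℂ 𝔽)
          ∪ (ιF '' {p : 𝔸 | p.totalDegree ≤ e ∧ ∀ g' : G, g' • p = p})) = 𝕂} = n ∧
    sInf {e : ℕ | Subfield.closure
        (Set.range (algebraMap ℂ 𝔽)
          ∪ (ιF '' {p : 𝔸 | p.totalDegree ≤ e ∧ ∀ g' : G, g' • p = p})) = 𝕂}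
      = 2 * sInf {e : ℕ | Submodule.span 𝕂 (ιF '' {p : 𝔸 | p.totalDegree ≤ e}) = ⊤} + 1 := by
  have hn : n ≠ 0 := by rintro rfl; simp at hodd
  have h0 := hζ.ne_zero hn
  have hinj := IsFractionRing.injective 𝔸 𝔽
  have halg : ∀ c : ℂ, algebraMap ℂ 𝔽 c = ιF (C c) := fun c =>
    IsScalarTower.algebraMap_apply ℂ 𝔸 𝔽 c
  have hCA : ∀ (g' : G) (c : ℂ), g' • (C c : 𝔸) = C c := fun g' c => by
    rw [← mul_one (C c), ← smul_eq_C_mul, smul_comm, smul_one]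
  have hfixA : ∀ p : 𝔸, g • p = p → ∀ g' : G, g' • p = p := fun p hp g' => by
    have : Subgroup.zpowers g ≤ MulAction.stabilizer G p := by
      rw [Subgroup.zpowers_le]; exact hp
    exact this (hgen g')
  have hK : ∀ p : 𝔸, (∀ g' : G, g' • p = p) → ιF p ∈ 𝕂 := fun p hp g' => by
    rw [hcomp, hp]
  have hKC : ∀ c : ℂ, ιF (C c) ∈ 𝕂 := fun c => hK _ fun g' => hCA g' c
  have hxyA : ∀ g' : G, g' • (X 0 * X 1 : 𝔸) = X 0 * X 1 := by
    apply hfixA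
    rw [smul_mul', hgx, hgy, mul_mul_mul_comm, ← C_mul, inv_mul_cancel₀ h0, C_1, one_mul]
  have hxnA : ∀ g' : G, g' • (X 0 ^ n : 𝔸) = X 0 ^ n := by
    apply hfixA
    rw [smul_pow', hgx, mul_pow, ← C_pow, inv_pow, hζ.pow_eq_one, inv_one, C_1, one_mul]
  have hLI : LinearIndependent 𝕂 (fun m : {m : ℤ // m.natAbs ≤ (n - 1) / 2} =>
        ιF (if 0 ≤ m.1 then (X 1 : 𝔸) ^ m.1.toNat else (X 0 : 𝔸) ^ (-m.1).toNat)) := by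
    refine LI_aux g _ (fun m => ⟨ιF (C (ζ ^ m.1)), hKC _⟩) ?_ ?_ ?_
    · intro a b hab
      have h1 : ζ ^ a.1 = ζ ^ b.1 := C_injective (Fin 2) ℂ (hinj (congrArg Subtype.val hab))
      have h2 : ζ ^ (a.1 - b.1) = 1 := by
        rw [zpow_sub₀ h0, h1, div_self (zpow_ne_zero _ h0)]
      rw [hζ.zpow_eq_one_iff_dvd] at h2
      have h3 := a.2
      have h4 := b.2
      have h5 := Int.eq_zero_of_abs_lt_dvd h2 (by rw [abs_lt]; omega)
      exact Subtype.ext (by omega)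
    · intro m h
      have h := hinj (h.trans (map_zero ιF).symm)
      split_ifs at h
      · exact pow_ne_zero _ (X_ne_zero _) h
      · exact pow_ne_zero _ (X_ne_zero _) h
    · intro m
      change g • ιF _ = ιF _ * ιF _
      rw [hcomp, ← map_mul]
      congr 1
      split_ifs with h
      · rw [smul_pow', hgy, mul_pow, ← C_pow, ← zpow_natCast ζ, Int.toNat_of_nonneg h]
      · rw [smul_pow', hgx, mul_pow, ← C_pow, ← zpow_natCast ζ⁻¹, Int.toNat_of_nonneg (by omega),
          inv_zpow', neg_neg]
  have hspan : Submodule.span 𝕂 (Set.range (fun m : {m : ℤ // m.natAbs ≤ (n - 1) / 2} =>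
        ιF (if 0 ≤ m.1 then (X 1 : 𝔸) ^ m.1.toNat else (X 0 : 𝔸) ^ (-m.1).toNat))) = ⊤ := by
    let I : Fintype {m : ℤ // m.natAbs ≤ (n - 1) / 2} :=
      Fintype.subtype (Finset.Icc (-(((n - 1) / 2 : ℕ) : ℤ)) (((n - 1) / 2 : ℕ) : ℤ)) (by
        intro x; rw [Finset.mem_Icc]; omega)
    refine span_aux _ ?_ hLI
    rw [Fintype.subtype_card, hcard, Int.card_Icc]
    obtain ⟨k, hk⟩ := hodd
    omega
  have hD : sInf {e : ℕ | Submodule.span 𝕂 (ιF '' {p : 𝔸 | p.totalDegree ≤ e}) = ⊤}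
      = (n - 1) / 2 := by
    refine IsLeast.csInf_eq ⟨?_, ?_⟩
    · change _ = _
      rw [eq_top_iff, ← hspan]
      apply Submodule.span_mono
      rintro _ ⟨m, rfl⟩
      refine ⟨_, ?_, rfl⟩
      have hm := m.2
      change totalDegree _ ≤ _
      split_ifs with h
      · rw [totalDegree_X_pow]; omega
      · rw [totalDegree_X_pow]; omega
    · intro e he
      change _ = _ at he
      by_contra! hlt
      have hno := hLI.notMem_span_image (s := {m | m.1.natAbs ≤ e})
        (x := ⟨(((n - 1) / 2 : ℕ) : ℤ), by omega⟩) (by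
          change ¬ (Int.natAbs _ ≤ e)
          simp only []
          omega)
      apply hno
      have hle : Submodule.span 𝕂 (ιF '' {p : 𝔸 | p.totalDegree ≤ e}) ≤
          Submodule.span 𝕂 ((fun m : {m : ℤ // m.natAbs ≤ (n - 1) / 2} =>
        ιF (if 0 ≤ m.1 then (X 1 : 𝔸) ^ m.1.toNat else (X 0 : 𝔸) ^ (-m.1).toNat)) ''
          {m | m.1.natAbs ≤ e}) := by
        rw [Submodule.span_le]
        rintro _ ⟨p, hp, rfl⟩
        refine span_deg_aux 𝕂 hKC (hK _ hxyA) e _ ?_ ?_ p hp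
        · intro i hi
          apply Submodule.subset_span
          refine ⟨⟨-(i : ℤ), by omega⟩, by change Int.natAbs _ ≤ e; simp only []; omega, ?_⟩
          by_cases h : i = 0
          · subst h; simp
          · simp [h]
        · intro i hi
          apply Submodule.subset_span
          refine ⟨⟨(i : ℤ), by omega⟩, by change Int.natAbs _ ≤ e; simp only []; omega, ?_⟩
          simp
      rw [he] at hle
      exact hle Submodule.mem_top
  have hle : ∀ e : ℕ, Subfield.closure
        (Set.range (algebraMap ℂ 𝔽)
          ∪ (ιF '' {p : 𝔸 | p.totalDegree ≤ e ∧ ∀ g' : G, g' • p = p})) ≤ 𝕂 := by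
    intro e
    rw [Subfield.closure_le]
    rintro _ (⟨c, rfl⟩ | ⟨p, hp, rfl⟩)
    · rw [halg]; exact hKC c
    · exact hK p hp.2
  have hne : ∀ e : ℕ, e < n → Subfield.closure
        (Set.range (algebraMap ℂ 𝔽)
          ∪ (ιF '' {p : 𝔸 | p.totalDegree ≤ e ∧ ∀ g' : G, g' • p = p})) ≠ 𝕂 := by
    intro e he heq
    refine not_mem_aux (F := 𝔽) hn _ ?_ (heq ▸ hK _ hxnA)
    intro L hC hxy
    rintro _ (⟨c, rfl⟩ | ⟨p, hp, rfl⟩)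
    · rw [halg]; exact hC c
    · exact deg_lt_aux hζ hn g hgx hgy L hC hxy p (hp.2 g) (lt_of_le_of_lt hp.1 he)
  have hB : sInf {e : ℕ | Subfield.closure
        (Set.range (algebraMap ℂ 𝔽)
          ∪ (ιF '' {p : 𝔸 | p.totalDegree ≤ e ∧ ∀ g' : G, g' • p = p})) = 𝕂} = n := by
    refine IsLeast.csInf_eq ⟨?_, ?_⟩
    · refine le_antisymm (hle n) (gen_aux hζ hn g hgx hgy hcomp _ ?_ ?_ ?_)
      · intro c
        exact Subfield.subset_closure (Or.inl ⟨c, halg c⟩)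
      · exact Subfield.subset_closure (Or.inr ⟨_, ⟨by rw [totalDegree_X_pow], hxnA⟩, rfl⟩)
      · by_cases h1 : n = 1
        · subst h1
          have : Subsingleton G := Fintype.card_le_one_iff_subsingleton.1 hcard.le
          have hs : ∀ (p : 𝔸) (g' : G), g' • p = p := fun p g' => by
            rw [Subsingleton.elim g' 1, one_smul]
          rw [map_mul]
          apply Subfield.mul_mem
          · exact Subfield.subset_closure (Or.inr ⟨_, ⟨by rw [totalDegree_X], hs _⟩, rfl⟩)
          · exact Subfield.subset_closure (Or.inr ⟨_, ⟨by rw [totalDegree_X], hs _⟩, rfl⟩)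
        · refine Subfield.subset_closure (Or.inr ⟨_, ⟨?_, hxyA⟩, rfl⟩)
          refine (totalDegree_mul _ _).trans ?_
          rw [totalDegree_X, totalDegree_X]
          omega
    · intro e he
      by_contra! hlt
      exact hne e hlt he
  refine ⟨hLI, hspan, hD, ?_, hne _ (by omega), hB, ?_⟩
  · apply le_antisymm
    · rw [Subfield.closure_le]
      rintro _ (⟨c, rfl⟩ | rfl | rfl)
      · rw [halg]; exact hKC c
      · exact hK _ hxnA
      · exact hK _ hxyA
    · refine gen_aux hζ hn g hgx hgy hcomp _ ?_ ?_ ?_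
      · intro c
        exact Subfield.subset_closure (Or.inl ⟨c, halg c⟩)
      · exact Subfield.subset_closure (Or.inr (Or.inl rfl))
      · exact Subfield.subset_closure (Or.inr (Or.inr rfl))
  · rw [hB, hD]
    obtain ⟨k, hk⟩ := hodd
    omega

end
end

section
/- Let G = Q₈ = ⟨i, j⟩ be the quaternion group acting on V = ℂ² via i ↦ [[0,−1],[1,0]] and j ↦ [[−i,0],[0,i]], so that on the coordinate functions x, y one has i·x = y, i·y = −x, j·x = ix, j·y = −iy. Let a₁ = −2xy/(x⁴−y⁴) and a₂ = (x⁴+y⁴)/(xy(x⁴−y⁴)) in ℂ(x,y)^{Q₈}. Then the identities x²y² = 1/(a₂² − a₁²), x⁴+y⁴ = 2a₂/(a₁³ − a₁a₂²), and xy(x⁴−y⁴) = 2/(a₁³ − a₁a₂²) hold in ℂ(x,y); in particular ℂ(x,y)^{Q₈} = ℂ(a₁, a₂), and the invariant field is not generated over ℂ by the invariant polynomials of degree at most 5, so β_field(Q₈, V) = 6. -/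
open MvPolynomial

set_option synthInstance.maxHeartbeats 1000000
set_option maxHeartbeats 1000000


theorem q8_id1 {K : Type*} [Field K] (x y : K) (hx : x ≠ 0) (hy : y ≠ 0)
    (hD : x ^ 4 - y ^ 4 ≠ 0) :
    ((x ^ 4 + y ^ 4) / (x * y * (x ^ 4 - y ^ 4))) ^ 2 - (-(2 * x * y) / (x ^ 4 - y ^ 4)) ^ 2
      = 1 / (x ^ 2 * y ^ 2) := by
  generalize hd : x ^ 4 - y ^ 4 = d at *
  have h2 : (x ^ 4 + y ^ 4) ^ 2 = d ^ 2 + 4 * x ^ 4 * y ^ 4 := by rw [← hd]; ring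
  rw [div_pow, h2]
  field_simp
  ring

theorem q8_id2 {K : Type*} [Field K] (x y : K) (hx : x ≠ 0) (hy : y ≠ 0)
    (hD : x ^ 4 - y ^ 4 ≠ 0) :
    (-(2 * x * y) / (x ^ 4 - y ^ 4)) ^ 3 - (-(2 * x * y) / (x ^ 4 - y ^ 4)) *
      ((x ^ 4 + y ^ 4) / (x * y * (x ^ 4 - y ^ 4))) ^ 2
      = 2 / (x * y * (x ^ 4 - y ^ 4)) := by
  have h := q8_id1 x y hx hy hD
  have h' : (-(2 * x * y) / (x ^ 4 - y ^ 4)) ^ 3 - (-(2 * x * y) / (x ^ 4 - y ^ 4)) *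
      ((x ^ 4 + y ^ 4) / (x * y * (x ^ 4 - y ^ 4))) ^ 2 =
      - (-(2 * x * y) / (x ^ 4 - y ^ 4)) * (1 / (x ^ 2 * y ^ 2)) := by
    rw [← h]; ring
  rw [h']
  field_simp

theorem q8_pow {K : Type*} [Field K] (L : Subfield K) (x y : K)
    (hs : x ^ 4 + y ^ 4 ∈ L) (hq : x ^ 2 * y ^ 2 ∈ L) (hw : x * y * (x ^ 4 - y ^ 4) ∈ L)
    (k : ℕ) : (x ^ (4 * k) + y ^ (4 * k) ∈ L ∧ x * y * (x ^ (4 * k) - y ^ (4 * k)) ∈ L) ∧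
      (x ^ (4 * (k + 1)) + y ^ (4 * (k + 1)) ∈ L ∧
        x * y * (x ^ (4 * (k + 1)) - y ^ (4 * (k + 1))) ∈ L) := by
  induction k with
  | zero =>
    refine ⟨⟨?_, ?_⟩, ?_, ?_⟩
    · simpa using L.add_mem L.one_mem L.one_mem
    · simp
    · simpa using hs
    · simpa using hw
  | succ k ih =>
    obtain ⟨⟨h1, h2⟩, h3, h4⟩ := ih
    refine ⟨⟨h3, h4⟩, ?_, ?_⟩
    · have := L.sub_mem (L.mul_mem hs h3) (L.mul_mem (L.pow_mem hq 2) h1)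
      convert this using 1
      ring
    · have := L.sub_mem (L.mul_mem hs h4) (L.mul_mem (L.pow_mem hq 2) h2)
      convert this using 1
      ring

theorem q8_mem0 {K : Type*} [Field K] (L : Subfield K) (x y : K)
    (hs : x ^ 4 + y ^ 4 ∈ L) (hq : x ^ 2 * y ^ 2 ∈ L) (hw : x * y * (x ^ 4 - y ^ 4) ∈ L)
    (b k : ℕ) : x ^ (b + 4 * k) * y ^ b + (-1) ^ b * (x ^ b * y ^ (b + 4 * k)) ∈ L := by
  obtain ⟨⟨h1, h2⟩, -⟩ := q8_pow L x y hs hq hw k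
  obtain ⟨m, hm | hm⟩ := Nat.even_or_odd' b
  · subst hm
    have := L.mul_mem (L.pow_mem hq m) h1
    convert this using 1
    rw [Even.neg_one_pow (even_two_mul m)]
    ring
  · subst hm
    have := L.mul_mem (L.pow_mem hq m) h2
    convert this using 1
    rw [Odd.neg_one_pow (odd_two_mul_add_one m)]
    ring

theorem q8_mem {K : Type*} [Field K] (L : Subfield K) (x y : K)
    (hs : x ^ 4 + y ^ 4 ∈ L) (hq : x ^ 2 * y ^ 2 ∈ L) (hw : x * y * (x ^ 4 - y ^ 4) ∈ L)
    (a b : ℕ) (hab : 4 ∣ a + 3 * b) : x ^ a * y ^ b + (-1) ^ b * (x ^ b * y ^ a) ∈ L := by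
  rcases le_total b a with h | h
  · obtain ⟨k, rfl⟩ : ∃ k, a = b + 4 * k := ⟨(a - b) / 4, by omega⟩
    exact q8_mem0 L x y hs hq hw b k
  · obtain ⟨k, rfl⟩ : ∃ k, b = a + 4 * k := ⟨(b - a) / 4, by omega⟩
    have h1 := q8_mem0 L x y hs hq hw a k
    have h2 : ((-1 : K)) ^ (a + 4 * k) = (-1) ^ a := by
      rw [pow_add, pow_mul]; norm_num
    rw [h2]
    have h3 : ((-1 : K)) ^ a ∈ L := L.pow_mem (L.neg_mem L.one_mem) a
    have h4 : ((-1 : K)) ^ a * (-1) ^ a = 1 := by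
      rw [← mul_pow]; norm_num
    convert L.mul_mem h3 h1 using 1
    linear_combination (-(x ^ a * y ^ (a + 4 * k))) * h4

theorem q8_key (S : Submodule ℂ (MvPolynomial (Fin 2) ℂ))
    (fi fj : MvPolynomial (Fin 2) ℂ →ₐ[ℂ] MvPolynomial (Fin 2) ℂ)
    (hix : fi (X 0) = X 1) (hiy : fi (X 1) = -X 0)
    (hjx : fj (X 0) = C Complex.I * X 0) (hjy : fj (X 1) = -(C Complex.I) * X 1)
    (p : MvPolynomial (Fin 2) ℂ) (hpi : fi p = p) (hpj : fj p = p)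
    (h : ∀ m ∈ p.support, 4 ∣ m 0 + 3 * m 1 →
      (X 0 ^ (m 0) * X 1 ^ (m 1) + (-1) ^ (m 1) * (X 0 ^ (m 1) * X 1 ^ (m 0)) :
        MvPolynomial (Fin 2) ℂ) ∈ S) : p ∈ S := by
  let T : MvPolynomial (Fin 2) ℂ →ₗ[ℂ] MvPolynomial (Fin 2) ℂ :=
    LinearMap.id + fj.toLinearMap + fj.toLinearMap ∘ₗ fj.toLinearMap +
      fj.toLinearMap ∘ₗ fj.toLinearMap ∘ₗ fj.toLinearMap
  let Φ : MvPolynomial (Fin 2) ℂ →ₗ[ℂ] MvPolynomial (Fin 2) ℂ := T + fi.toLinearMap ∘ₗ T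
  have hT : ∀ q, T q = q + fj q + fj (fj q) + fj (fj (fj q)) := fun q => rfl
  have hΦ : ∀ q, Φ q = T q + fi (T q) := fun q => rfl
  have hTp : T p = (4 : ℂ) • p := by
    rw [hT, hpj, hpj, hpj]; module
  have hΦp : Φ p = (8 : ℂ) • p := by
    rw [hΦ, hTp, map_smul, hpi]; module
  have hmono : ∀ m ∈ p.support, Φ (X 0 ^ (m 0) * X 1 ^ (m 1)) ∈ S := by
    intro m hm
    set z : ℂ := Complex.I ^ (m 0 + 3 * m 1) with hz
    have hfj : fj (X 0 ^ (m 0) * X 1 ^ (m 1)) = z • (X 0 ^ (m 0) * X 1 ^ (m 1)) := by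
      have h3 : (-(C Complex.I) : MvPolynomial (Fin 2) ℂ) = C (Complex.I ^ 3) := by
        rw [Complex.I_pow_three, map_neg]
      rw [map_mul, map_pow, map_pow, hjx, hjy, h3, smul_eq_C_mul, hz, pow_add, pow_mul,
        map_mul]
      simp only [map_pow, mul_pow]
      ring
    have hTm : T (X 0 ^ (m 0) * X 1 ^ (m 1)) =
        (1 + z + z ^ 2 + z ^ 3) • (X 0 ^ (m 0) * X 1 ^ (m 1)) := by
      rw [hT]
      simp only [hfj, map_smul]
      module
    by_cases hd : 4 ∣ m 0 + 3 * m 1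
    · have hz1 : z = 1 := by
        obtain ⟨k, hk⟩ := hd
        rw [hz, hk, pow_mul, Complex.I_pow_four, one_pow]
      have : Φ (X 0 ^ (m 0) * X 1 ^ (m 1)) = (4 : ℂ) • (X 0 ^ (m 0) * X 1 ^ (m 1) +
          (-1) ^ (m 1) * (X 0 ^ (m 1) * X 1 ^ (m 0))) := by
        rw [hΦ, hTm, hz1, map_smul, map_mul, map_pow, map_pow, hix, hiy,
          neg_pow (X 0 : MvPolynomial (Fin 2) ℂ), ← smul_add]
        congr 1
        · norm_num
        · ring
      rw [this]
      exact S.smul_mem _ (h m hm hd)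
    · have hz0 : 1 + z + z ^ 2 + z ^ 3 = 0 := by
        have h4 : Complex.I ^ (m 0 + 3 * m 1) = Complex.I ^ ((m 0 + 3 * m 1) % 4) := by
          conv_lhs => rw [← Nat.div_add_mod (m 0 + 3 * m 1) 4, pow_add, pow_mul,
            Complex.I_pow_four, one_pow, one_mul]
        have h5 : (m 0 + 3 * m 1) % 4 = 1 ∨ (m 0 + 3 * m 1) % 4 = 2 ∨
          (m 0 + 3 * m 1) % 4 = 3 := by omega
        have hI := Complex.I_sq
        rw [hz, h4]
        rcases h5 with h5 | h5 | h5 <;> rw [h5]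
        · linear_combination (1 + Complex.I) * hI
        · rw [hI]; norm_num
        · rw [Complex.I_pow_three]
          linear_combination (1 - Complex.I) * hI
      rw [hΦ, hTm, hz0]
      simp
  have h8 : (8 : ℂ) • p ∈ S := by
    have hs : Φ p = ∑ m ∈ p.support, Φ (monomial m (coeff m p)) := by
      conv_lhs => rw [p.as_sum]
      rw [map_sum]
    rw [← hΦp, hs]
    refine S.sum_mem fun m hm => ?_
    have : monomial m (coeff m p) = coeff m p • (X 0 ^ (m 0) * X 1 ^ (m 1)) := by
      rw [monomial_eq, smul_eq_C_mul, Finsupp.prod_fintype _ _ (by simp), Fin.prod_univ_two]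
    rw [this, map_smul]
    exact S.smul_mem _ (hmono m hm)
  have := S.smul_mem (8⁻¹ : ℂ) h8
  rwa [smul_smul, inv_mul_cancel₀ (by norm_num), one_smul] at this

theorem q8_swap (fi fj : MvPolynomial (Fin 2) ℂ →ₐ[ℂ] MvPolynomial (Fin 2) ℂ)
    (hix : fi (X 0) = X 1) (hiy : fi (X 1) = -X 0)
    (hjx : fj (X 0) = C Complex.I * X 0) (hjy : fj (X 1) = -(C Complex.I) * X 1)
    (p : MvPolynomial (Fin 2) ℂ) (hpi : fi p = p) (hpj : fj p = p) (hdeg : p.totalDegree ≤ 5) :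
    rename (Equiv.swap (0 : Fin 2) 1) p = p := by
  let S : Submodule ℂ (MvPolynomial (Fin 2) ℂ) := LinearMap.eqLocus
    (rename (R := ℂ) (Equiv.swap (0 : Fin 2) 1)).toLinearMap LinearMap.id
  have hS : ∀ q, q ∈ S ↔ rename (Equiv.swap (0 : Fin 2) 1) q = q := fun q => Iff.rfl
  rw [← hS]
  refine q8_key S fi fj hix hiy hjx hjy p hpi hpj fun m hm hd => ?_
  have hm5 : m 0 + m 1 ≤ 5 := by
    have h1 := le_totalDegree hm
    rw [Finsupp.sum_fintype _ _ (by simp), Fin.sum_univ_two] at h1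
    omega
  rw [hS]
  simp only [map_add, map_mul, map_pow, map_neg, map_one, rename_X, Equiv.swap_apply_left,
    Equiv.swap_apply_right]
  obtain ⟨k, hk | hk⟩ := Nat.even_or_odd' (m 1)
  · rw [Even.neg_one_pow ⟨k, by omega⟩]
    ring
  · have h1 : m 0 = m 1 := by omega
    rw [h1]
    ring

theorem q8_fwd {K : Type*} [Field K] (L : Subfield K) (x y : K) (hx : x ≠ 0) (hy : y ≠ 0)
    (hD : x ^ 4 - y ^ 4 ≠ 0) (h20 : (2 : K) ≠ 0)
    (h1 : -(2 * x * y) / (x ^ 4 - y ^ 4) ∈ L)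
    (h2 : (x ^ 4 + y ^ 4) / (x * y * (x ^ 4 - y ^ 4)) ∈ L) :
    x ^ 4 + y ^ 4 ∈ L ∧ x ^ 2 * y ^ 2 ∈ L ∧ x * y * (x ^ 4 - y ^ 4) ∈ L := by
  have e1 := q8_id1 x y hx hy hD
  have e2 := q8_id2 x y hx hy hD
  have m1 : 1 / (x ^ 2 * y ^ 2) ∈ L := by
    rw [← e1]; exact L.sub_mem (L.pow_mem h2 2) (L.pow_mem h1 2)
  have m2 : 2 / (x * y * (x ^ 4 - y ^ 4)) ∈ L := by
    rw [← e2]; exact L.sub_mem (L.pow_mem h1 3) (L.mul_mem h1 (L.pow_mem h2 2))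
  have h2L : (2 : K) ∈ L := ofNat_mem L 2
  have m3 : x * y * (x ^ 4 - y ^ 4) ∈ L := by
    have := L.div_mem h2L m2
    rwa [div_div_cancel₀ h20] at this
  refine ⟨?_, ?_, m3⟩
  · have := L.mul_mem h2 m3
    rwa [div_mul_cancel₀ _ (mul_ne_zero (mul_ne_zero hx hy) hD)] at this
  · have := L.inv_mem m1
    rwa [one_div, inv_inv] at this

theorem q8_bwd {K : Type*} [Field K] (L : Subfield K) (x y : K) (hx : x ≠ 0) (hy : y ≠ 0)
    (hs : x ^ 4 + y ^ 4 ∈ L) (hq : x ^ 2 * y ^ 2 ∈ L) (hw : x * y * (x ^ 4 - y ^ 4) ∈ L) :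
    -(2 * x * y) / (x ^ 4 - y ^ 4) ∈ L ∧
    (x ^ 4 + y ^ 4) / (x * y * (x ^ 4 - y ^ 4)) ∈ L := by
  refine ⟨?_, L.div_mem hs hw⟩
  have h2L : (2 : K) ∈ L := ofNat_mem L 2
  have := L.div_mem (L.neg_mem (L.mul_mem h2L hq)) hw
  convert this using 1
  field_simp


section

variable (G : Type*) [Group G] [Fintype G]
  [MulSemiringAction G (MvPolynomial (Fin 2) ℂ)]
  [MulSemiringAction G (FractionRing (MvPolynomial (Fin 2) ℂ))]

local notation "𝔸" => MvPolynomial (Fin 2) ℂ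
local notation "𝔽" => FractionRing (MvPolynomial (Fin 2) ℂ)
local notation "𝕂" => FixedPoints.subfield G (FractionRing (MvPolynomial (Fin 2) ℂ))
local notation "ιF" =>
  algebraMap (MvPolynomial (Fin 2) ℂ) (FractionRing (MvPolynomial (Fin 2) ℂ))

/-- **Example (the quaternion group `Q₈` on `ℂ²`).** Let `G = Q₈ = ⟨i, j⟩` (a group of order
`8` generated by elements `i, j` acting faithfully) act on `V = ℂ²` so that on the coordinate
functions `x = X 0`, `y = X 1` one has `i·x = y`, `i·y = −x`, `j·x = I·x`, `j·y = −I·y`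
(`I = √−1`).  Put `a₁ = −2xy/(x⁴−y⁴)` and `a₂ = (x⁴+y⁴)/(xy(x⁴−y⁴))`.  Then `a₁, a₂` are
invariant, the identities `x²y² = 1/(a₂²−a₁²)`, `x⁴+y⁴ = 2a₂/(a₁³−a₁a₂²)`,
`xy(x⁴−y⁴) = 2/(a₁³−a₁a₂²)` hold in `ℂ(x,y)`; in particular `ℂ(x,y)^{Q₈} = ℂ(a₁,a₂)`.
Moreover the invariant field is not generated over `ℂ` by the invariant polynomials of
degree at most `5`, so `β_field(Q₈,V) = 6`. -/
theorem quaternion_example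
    [SMulCommClass G ℂ (MvPolynomial (Fin 2) ℂ)]
    (hcard : Fintype.card G = 8)
    (i j : G) (hgen : ∀ x : G, x ∈ Subgroup.closure ({i, j} : Set G))
    (hfaithful : ∀ g : G, (∀ p : 𝔸, g • p = p) → g = 1)
    (hix : i • (X 0 : 𝔸) = X 1) (hiy : i • (X 1 : 𝔸) = -X 0)
    (hjx : j • (X 0 : 𝔸) = MvPolynomial.C Complex.I * X 0)
    (hjy : j • (X 1 : 𝔸) = -(MvPolynomial.C Complex.I) * X 1)
    (hcomp : ∀ (g : G) (p : 𝔸), g • (ιF p) = ιF (g • p)) :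
    ((-(2 * ιF (X 0) * ιF (X 1)) / (ιF (X 0) ^ 4 - ιF (X 1) ^ 4)) ∈ 𝕂 ∧
    ((ιF (X 0) ^ 4 + ιF (X 1) ^ 4) /
        (ιF (X 0) * ιF (X 1) * (ιF (X 0) ^ 4 - ιF (X 1) ^ 4))) ∈ 𝕂) ∧
    -- the three identities expressing the generating invariants in terms of `a₁, a₂`
    (ιF (X 0) ^ 2 * ιF (X 1) ^ 2 =
      1 / (((ιF (X 0) ^ 4 + ιF (X 1) ^ 4) /
            (ιF (X 0) * ιF (X 1) * (ιF (X 0) ^ 4 - ιF (X 1) ^ 4))) ^ 2 -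
          ((-(2 * ιF (X 0) * ιF (X 1)) / (ιF (X 0) ^ 4 - ιF (X 1) ^ 4))) ^ 2) ∧
    ιF (X 0) ^ 4 + ιF (X 1) ^ 4 =
      2 * ((ιF (X 0) ^ 4 + ιF (X 1) ^ 4) /
            (ιF (X 0) * ιF (X 1) * (ιF (X 0) ^ 4 - ιF (X 1) ^ 4))) /
        (((-(2 * ιF (X 0) * ιF (X 1)) / (ιF (X 0) ^ 4 - ιF (X 1) ^ 4))) ^ 3 -
          ((-(2 * ιF (X 0) * ιF (X 1)) / (ιF (X 0) ^ 4 - ιF (X 1) ^ 4))) *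
            ((ιF (X 0) ^ 4 + ιF (X 1) ^ 4) /
              (ιF (X 0) * ιF (X 1) * (ιF (X 0) ^ 4 - ιF (X 1) ^ 4))) ^ 2) ∧
    ιF (X 0) * ιF (X 1) * (ιF (X 0) ^ 4 - ιF (X 1) ^ 4) =
      2 / (((-(2 * ιF (X 0) * ιF (X 1)) / (ιF (X 0) ^ 4 - ιF (X 1) ^ 4))) ^ 3 -
          ((-(2 * ιF (X 0) * ιF (X 1)) / (ιF (X 0) ^ 4 - ιF (X 1) ^ 4))) *
            ((ιF (X 0) ^ 4 + ιF (X 1) ^ 4) /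
              (ιF (X 0) * ιF (X 1) * (ιF (X 0) ^ 4 - ιF (X 1) ^ 4))) ^ 2)) ∧
    -- in particular `ℂ(x,y)^{Q₈} = ℂ(a₁, a₂)`
    Subfield.closure
        (Set.range (algebraMap ℂ 𝔽) ∪
          {(-(2 * ιF (X 0) * ιF (X 1)) / (ιF (X 0) ^ 4 - ιF (X 1) ^ 4)),
            ((ιF (X 0) ^ 4 + ιF (X 1) ^ 4) /
              (ιF (X 0) * ιF (X 1) * (ιF (X 0) ^ 4 - ιF (X 1) ^ 4)))}) = 𝕂 ∧
    -- the invariant field is not generated by the invariant polynomials of degree ≤ 5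
    Subfield.closure
        (Set.range (algebraMap ℂ 𝔽)
          ∪ (ιF '' {p : 𝔸 | p.totalDegree ≤ 5 ∧ ∀ g : G, g • p = p})) ≠ 𝕂 ∧
    -- so `β_field(Q₈, V) = 6`
    sInf {e : ℕ | Subfield.closure
        (Set.range (algebraMap ℂ 𝔽)
          ∪ (ιF '' {p : 𝔸 | p.totalDegree ≤ e ∧ ∀ g : G, g • p = p})) = 𝕂} = 6 := by
  classical
  -- the two generators as algebra maps
  let fi : 𝔸 →ₐ[ℂ] 𝔸 := MulSemiringAction.toAlgHom ℂ 𝔸 i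
  let fj : 𝔸 →ₐ[ℂ] 𝔸 := MulSemiringAction.toAlgHom ℂ 𝔸 j
  have hfi : ∀ p, fi p = i • p := fun p => rfl
  have hfj : ∀ p, fj p = j • p := fun p => rfl
  have fix : fi (X 0) = X 1 := hix
  have fiy : fi (X 1) = -X 0 := hiy
  have fjx : fj (X 0) = C Complex.I * X 0 := hjx
  have fjy : fj (X 1) = -(C Complex.I) * X 1 := hjy
  have hinj : Function.Injective ιF := IsFractionRing.injective _ _
  have hfix : ∀ p : 𝔸, fi p = p → fj p = p → ∀ g : G, g • p = p := by
    intro p h1 h2 g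
    have hle : Subgroup.closure ({i, j} : Set G) ≤ MulAction.stabilizer G p := by
      rw [Subgroup.closure_le]
      rintro a (rfl | rfl)
      · exact h1
      · exact h2
    exact hle (hgen g)
  have hI4 : (C Complex.I : 𝔸) ^ 4 = 1 := by rw [← map_pow, Complex.I_pow_four, map_one]
  have hI2 : (C Complex.I : 𝔸) ^ 2 = -1 := by rw [← map_pow, Complex.I_sq, map_neg, map_one]
  have hsinv : ∀ g : G, g • (X 0 ^ 4 + X 1 ^ 4 : 𝔸) = X 0 ^ 4 + X 1 ^ 4 := by
    apply hfix
    · simp only [map_add, map_pow, fix, fiy]; ring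
    · simp only [map_add, map_pow, fjx, fjy]
      linear_combination (X 0 ^ 4 + X 1 ^ 4) * hI4
  have hqinv : ∀ g : G, g • (X 0 ^ 2 * X 1 ^ 2 : 𝔸) = X 0 ^ 2 * X 1 ^ 2 := by
    apply hfix
    · simp only [map_mul, map_pow, fix, fiy]; ring
    · simp only [map_mul, map_pow, fjx, fjy]
      linear_combination (X 0 ^ 2 * X 1 ^ 2) * hI4
  have hwinv : ∀ g : G, g • (X 0 * X 1 * (X 0 ^ 4 - X 1 ^ 4) : 𝔸) =
      X 0 * X 1 * (X 0 ^ 4 - X 1 ^ 4) := by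
    apply hfix
    · simp only [map_mul, map_sub, map_pow, fix, fiy]; ring
    · simp only [map_mul, map_sub, map_pow, fjx, fjy, mul_pow, neg_pow (C Complex.I : 𝔸), hI4]
      linear_combination (-(X 0 * X 1 * (X 0 ^ 4 - X 1 ^ 4))) * hI2
  have hmemK : ∀ f : 𝔽, f ∈ 𝕂 ↔ ∀ g : G, g • f = f := fun f => Iff.rfl
  have hιK : ∀ p : 𝔸, (∀ g : G, g • p = p) → ιF p ∈ 𝕂 := by
    intro p hp
    rw [hmemK]
    intro g
    rw [hcomp, hp]
  have hCK : Set.range (algebraMap ℂ 𝔽) ⊆ (𝕂 : Set 𝔽) := by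
    rintro _ ⟨c, rfl⟩
    rw [IsScalarTower.algebraMap_apply ℂ 𝔸 𝔽]
    apply hιK
    intro g
    rw [Algebra.algebraMap_eq_smul_one, smul_comm, smul_one]
  -- nonvanishing
  have hx0 : ιF (X 0) ≠ 0 := by
    rw [Ne, map_eq_zero_iff _ hinj]; exact X_ne_zero 0
  have hy0 : ιF (X 1) ≠ 0 := by
    rw [Ne, map_eq_zero_iff _ hinj]; exact X_ne_zero 1
  have hDA : (X 0 ^ 4 - X 1 ^ 4 : 𝔸) ≠ 0 := by
    intro h
    have := congrArg (MvPolynomial.eval ![(1 : ℂ), 0]) h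
    simp at this
  have hD0 : ιF (X 0) ^ 4 - ιF (X 1) ^ 4 ≠ 0 := by
    rw [← map_pow, ← map_pow, ← map_sub, Ne, map_eq_zero_iff _ hinj]; exact hDA
  have h20 : (2 : 𝔽) ≠ 0 := by
    have : ιF (C 2) ≠ 0 := by
      rw [Ne, map_eq_zero_iff _ hinj, C_eq_zero]; norm_num
    simpa using this
  have es : ιF (X 0 ^ 4 + X 1 ^ 4) = ιF (X 0) ^ 4 + ιF (X 1) ^ 4 := by
    rw [map_add, map_pow, map_pow]
  have eq : ιF (X 0 ^ 2 * X 1 ^ 2) = ιF (X 0) ^ 2 * ιF (X 1) ^ 2 := by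
    rw [map_mul, map_pow, map_pow]
  have ew : ιF (X 0 * X 1 * (X 0 ^ 4 - X 1 ^ 4)) =
      ιF (X 0) * ιF (X 1) * (ιF (X 0) ^ 4 - ιF (X 1) ^ 4) := by
    rw [map_mul, map_mul, map_sub, map_pow, map_pow]
  have hsK := es ▸ hιK _ hsinv
  have hqK := eq ▸ hιK _ hqinv
  have hwK := ew ▸ hιK _ hwinv
  -- any subfield containing the constants and the three invariants contains the invariants
  have hbig : ∀ L : Subfield 𝔽, Set.range (algebraMap ℂ 𝔽) ⊆ (L : Set 𝔽) →
      ιF (X 0) ^ 4 + ιF (X 1) ^ 4 ∈ L → ιF (X 0) ^ 2 * ιF (X 1) ^ 2 ∈ L →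
      ιF (X 0) * ιF (X 1) * (ιF (X 0) ^ 4 - ιF (X 1) ^ 4) ∈ L → 𝕂 ≤ L := by
    intro L hC hs hq hw
    have hCL : ∀ c : ℂ, ιF (C c) ∈ L := by
      intro c
      apply hC
      exact ⟨c, IsScalarTower.algebraMap_apply ℂ 𝔸 𝔽 c⟩
    let S : Submodule ℂ 𝔸 :=
      { carrier := {p | ιF p ∈ L}
        add_mem' := fun {a b} ha hb => by
          simp only [Set.mem_ofPred_eq] at *
          rw [map_add]; exact L.add_mem ha hb
        zero_mem' := by simp only [Set.mem_ofPred_eq, map_zero]; exact L.zero_mem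
        smul_mem' := fun c a ha => by
          simp only [Set.mem_ofPred_eq] at *
          rw [smul_eq_C_mul, map_mul]; exact L.mul_mem (hCL c) ha }
    have hS : ∀ p, p ∈ S ↔ ιF p ∈ L := fun p => Iff.rfl
    have hpoly : ∀ p : 𝔸, (∀ g : G, g • p = p) → ιF p ∈ L := by
      intro p hp
      rw [← hS]
      refine q8_key S fi fj hix hiy hjx hjy p (hp i) (hp j) fun m _ hd => ?_
      rw [hS]
      have := q8_mem L _ _ hs hq hw (m 0) (m 1) hd
      simpa only [map_add, map_mul, map_pow, map_neg, map_one] using this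
    intro f hf
    rw [hmemK] at hf
    obtain ⟨n, d, hd, rfl⟩ := IsFractionRing.div_surjective (A := 𝔸) f
    have hd0 : d ≠ 0 := nonZeroDivisors.ne_zero hd
    let D : 𝔸 := ∏ g : G, g • d
    have hDinv : ∀ g : G, g • D = D := by
      intro g
      simp only [D]
      rw [Finset.smul_prod']
      simp only [smul_smul]
      exact Fintype.prod_equiv (Equiv.mulLeft g) _ _ (fun _ => rfl)
    have hDne : D ≠ 0 := by
      refine Finset.prod_ne_zero_iff.2 fun g _ h => hd0 ?_
      exact (smul_eq_zero_iff_eq g).1 h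
    let N : 𝔸 := n * ∏ g ∈ Finset.univ.erase (1 : G), g • d
    have hDd : D = d * ∏ g ∈ Finset.univ.erase (1 : G), g • d := by
      simp only [D]
      rw [← Finset.mul_prod_erase Finset.univ _ (Finset.mem_univ (1 : G)), one_smul]
    have hιd : ιF d ≠ 0 := by rwa [Ne, map_eq_zero_iff _ hinj]
    have hιD : ιF D ≠ 0 := by rwa [Ne, map_eq_zero_iff _ hinj]
    have hN : ιF N = ιF n / ιF d * ιF D := by
      rw [hDd, map_mul, map_mul, ← mul_assoc, div_mul_cancel₀ _ hιd]
    have hNinv : ∀ g : G, g • N = N := by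
      intro g
      apply hinj
      rw [← hcomp, hN, smul_mul', hf g, hcomp, hDinv]
    have : ιF n / ιF d = ιF N / ιF D := by
      rw [hN, mul_div_cancel_right₀ _ hιD]
    rw [this]
    exact L.div_mem (hpoly N hNinv) (hpoly D hDinv)
  have hle : ∀ e : ℕ, Subfield.closure (Set.range (algebraMap ℂ 𝔽)
      ∪ (ιF '' {p : 𝔸 | p.totalDegree ≤ e ∧ ∀ g : G, g • p = p})) ≤ 𝕂 := by
    intro e
    rw [Subfield.closure_le]
    refine Set.union_subset hCK ?_
    rintro _ ⟨p, ⟨_, hp⟩, rfl⟩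
    exact hιK p hp
  have hne : ∀ e : ℕ, e ≤ 5 → Subfield.closure (Set.range (algebraMap ℂ 𝔽)
      ∪ (ιF '' {p : 𝔸 | p.totalDegree ≤ e ∧ ∀ g : G, g • p = p})) ≠ 𝕂 := by
    intro e he heq
    let σ : 𝔸 ≃+* 𝔸 := (renameEquiv ℂ (Equiv.swap (0 : Fin 2) 1)).toRingEquiv
    have hσ : ∀ p, σ p = rename (Equiv.swap (0 : Fin 2) 1) p := fun p => rfl
    let τ : 𝔽 ≃+* 𝔽 := IsFractionRing.ringEquivOfRingEquiv σ
    have hτ : ∀ p : 𝔸, τ (ιF p) = ιF (rename (Equiv.swap (0 : Fin 2) 1) p) := fun p => by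
      rw [← hσ]; exact IsFractionRing.ringEquivOfRingEquiv_algebraMap σ p
    have hcl : Subfield.closure (Set.range (algebraMap ℂ 𝔽)
        ∪ (ιF '' {p : 𝔸 | p.totalDegree ≤ e ∧ ∀ g : G, g • p = p})) ≤
        RingHom.eqLocusField (τ : 𝔽 →+* 𝔽) (RingHom.id 𝔽) := by
      rw [Subfield.closure_le]
      refine Set.union_subset ?_ ?_
      · rintro _ ⟨c, rfl⟩
        show τ _ = _
        rw [IsScalarTower.algebraMap_apply ℂ 𝔸 𝔽, hτ]
        simp [MvPolynomial.algebraMap_eq]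
      · rintro _ ⟨p, ⟨hpd, hp⟩, rfl⟩
        show τ _ = _
        rw [hτ, q8_swap fi fj hix hiy hjx hjy p (hp i) (hp j) (hpd.trans he)]
        rfl
    rw [heq] at hcl
    have h1 : τ (ιF (X 0 * X 1 * (X 0 ^ 4 - X 1 ^ 4))) = ιF (X 0 * X 1 * (X 0 ^ 4 - X 1 ^ 4)) :=
      hcl (hιK _ hwinv)
    rw [hτ] at h1
    have h2 := hinj h1
    simp only [map_sub, map_mul, map_pow, rename_X, Equiv.swap_apply_left,
      Equiv.swap_apply_right] at h2
    have h3 := congrArg (MvPolynomial.eval ![(2 : ℂ), 1]) h2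
    simp at h3
    norm_num at h3
  have h6 : Subfield.closure (Set.range (algebraMap ℂ 𝔽)
      ∪ (ιF '' {p : 𝔸 | p.totalDegree ≤ 6 ∧ ∀ g : G, g • p = p})) = 𝕂 := by
    have hh : ∀ (p : 𝔸) (n : ℕ), n ≤ 6 → p.IsHomogeneous n → (∀ g : G, g • p = p) →
        ιF p ∈ Subfield.closure (Set.range (algebraMap ℂ 𝔽)
          ∪ (ιF '' {p : 𝔸 | p.totalDegree ≤ 6 ∧ ∀ g : G, g • p = p})) := by
      intro p n hn hp hg
      exact Subfield.subset_closure (Or.inr ⟨p, ⟨hp.totalDegree_le.trans hn, hg⟩, rfl⟩)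
    have hX : ∀ (k : Fin 2) (n : ℕ), (X k ^ n : 𝔸).IsHomogeneous n := fun k n => by
      simpa using (isHomogeneous_X ℂ k).pow n
    refine le_antisymm (hle 6) (hbig _ ?_ ?_ ?_ ?_)
    · exact fun a ha => Subfield.subset_closure (Or.inl ha)
    · rw [← es]
      exact hh _ 4 (by norm_num) ((hX 0 4).add (hX 1 4)) hsinv
    · rw [← eq]
      exact hh _ 4 (by norm_num) ((hX 0 2).mul (hX 1 2)) hqinv
    · rw [← ew]
      exact hh _ 6 le_rfl (((isHomogeneous_X ℂ 0).mul (isHomogeneous_X ℂ 1)).mul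
        ((hX 0 4).sub (hX 1 4))) hwinv
  have haK := q8_bwd 𝕂 _ _ hx0 hy0 hsK hqK hwK
  refine ⟨haK, ⟨?_, ?_, ?_⟩, ?_, hne 5 le_rfl, ?_⟩
  · rw [q8_id1 _ _ hx0 hy0 hD0, one_div_one_div]
  · rw [q8_id2 _ _ hx0 hy0 hD0, mul_div_assoc',
      div_div_div_cancel_right₀ (mul_ne_zero (mul_ne_zero hx0 hy0) hD0),
      mul_div_cancel_left₀ _ h20]
  · rw [q8_id2 _ _ hx0 hy0 hD0, div_div_cancel₀ h20]
  · apply le_antisymm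
    · rw [Subfield.closure_le]
      refine Set.union_subset hCK ?_
      rintro _ (rfl | rfl)
      · exact haK.1
      · exact haK.2
    · have := q8_fwd (Subfield.closure
        (Set.range (algebraMap ℂ 𝔽) ∪
          {(-(2 * ιF (X 0) * ιF (X 1)) / (ιF (X 0) ^ 4 - ιF (X 1) ^ 4)),
            ((ιF (X 0) ^ 4 + ιF (X 1) ^ 4) /
              (ιF (X 0) * ιF (X 1) * (ιF (X 0) ^ 4 - ιF (X 1) ^ 4)))})) _ _ hx0 hy0 hD0 h20
        (Subfield.subset_closure (Or.inr (Or.inl rfl)))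
        (Subfield.subset_closure (Or.inr (Or.inr rfl)))
      exact hbig _ (fun a ha => Subfield.subset_closure (Or.inl ha)) this.1 this.2.1 this.2.2
  · apply le_antisymm
    · exact Nat.sInf_le h6
    · refine le_csInf ⟨6, h6⟩ fun e he => ?_
      by_contra hlt
      exact hne e (by omega) he

end
end

section
/- Let V = ℂ⁴ be the canonical permutation representation of the alternating group A₄ over ℂ. Then ℂ[V]_{≤2} contains a ℂA₄-submodule isomorphic to the regular representation ℂA₄ (so D_reg(A₄,V) = 2), but ℂ[V]_{≤2} does not span ℂ(V) as a ℂ(V)^{A₄}-vector space; in fact D_span(A₄,V) = 3. In particular the inequality D_reg ≤ D_span can be strict. -/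
open MvPolynomial

set_option synthInstance.maxHeartbeats 1000000
set_option maxHeartbeats 1000000


/-- The list of the twelve even permutations of four letters, as value tuples. -/
def a4List : Finset (Fin 4 × Fin 4 × Fin 4 × Fin 4) :=
  {(0, 1, 2, 3), (0, 2, 3, 1), (0, 3, 1, 2), (1, 0, 3, 2), (1, 2, 0, 3), (1, 3, 2, 0),
   (2, 0, 1, 3), (2, 1, 3, 0), (2, 3, 0, 1), (3, 0, 2, 1), (3, 1, 0, 2), (3, 2, 1, 0)}

def a4Tup (g : alternatingGroup (Fin 4)) : Fin 4 × Fin 4 × Fin 4 × Fin 4 :=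
  ((g : Equiv.Perm (Fin 4)) 0, (g : Equiv.Perm (Fin 4)) 1, (g : Equiv.Perm (Fin 4)) 2,
    (g : Equiv.Perm (Fin 4)) 3)

theorem a4Tup_mem : ∀ g, a4Tup g ∈ a4List := by decide +kernel

theorem a4Tup_image : Finset.univ.image a4Tup = a4List := by decide +kernel

theorem a4Tup_inj : Function.Injective a4Tup := by
  have : ∀ g h, a4Tup g = a4Tup h → g = h := by decide +kernel
  exact fun g h => this g h

theorem a4_sum {M : Type*} [AddCommMonoid M] (F : Fin 4 → Fin 4 → Fin 4 → Fin 4 → M) :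
    ∑ g : alternatingGroup (Fin 4), F ((g : Equiv.Perm (Fin 4)) 0) ((g : Equiv.Perm (Fin 4)) 1)
      ((g : Equiv.Perm (Fin 4)) 2) ((g : Equiv.Perm (Fin 4)) 3) =
    F 0 1 2 3 + (F 0 2 3 1 + (F 0 3 1 2 + (F 1 0 3 2 + (F 1 2 0 3 + (F 1 3 2 0 +
    (F 2 0 1 3 + (F 2 1 3 0 + (F 2 3 0 1 + (F 3 0 2 1 + (F 3 1 0 2 + F 3 2 1 0)))))))))) := by
  have h := Finset.sum_image (s := Finset.univ) (g := a4Tup)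
    (f := fun t : Fin 4 × Fin 4 × Fin 4 × Fin 4 => F t.1 t.2.1 t.2.2.1 t.2.2.2)
    (fun a _ b _ h => a4Tup_inj h)
  rw [a4Tup_image] at h
  simp only [a4Tup] at h
  rw [← h]
  simp [a4List]

/-- Ten evaluation points with integer weights. -/
def wt : List (ℤ × (Fin 4 → ℤ)) :=
  [(-4, ![-1, 0, 0, 0]), (-2, ![0, -1, 0, 0]), (-6, ![0, 0, -1, 0]), (-1, ![0, 0, 0, 1]),
   (-1, ![0, 0, 1, 0]), (1, ![0, 1, 0, 0]), (1, ![1, 0, 0, 0]), (4, ![-1, 0, -1, 0]),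
   (-2, ![-1, 0, 0, -1]), (2, ![0, -1, -1, 0])]

theorem wt_dual : ∀ g : alternatingGroup (Fin 4),
    (wt.map fun cv => cv.1 * (cv.2 ((g : Equiv.Perm (Fin 4)) 0)
      + cv.2 ((g : Equiv.Perm (Fin 4)) 1) ^ 2
      + cv.2 ((g : Equiv.Perm (Fin 4)) 0) * cv.2 ((g : Equiv.Perm (Fin 4)) 2))).sum
      = if g = 1 then 8 else 0 := by decide +kernel

noncomputable def phi : MvPolynomial (Fin 4) ℂ →ₗ[ℂ] ℂ :=
  (wt.map fun cv => (cv.1 : ℂ) • (aeval (fun i => ((cv.2 i : ℤ) : ℂ)) :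
    MvPolynomial (Fin 4) ℂ →ₐ[ℂ] ℂ).toLinearMap).sum

noncomputable def w0 : MvPolynomial (Fin 4) ℂ := X 0 + X 1 ^ 2 + X 0 * X 2

theorem phi_w0 (g : alternatingGroup (Fin 4)) :
    phi (rename (g : Equiv.Perm (Fin 4)) w0) = if g = 1 then 8 else 0 := by
  have h := congrArg (Int.cast : ℤ → ℂ) (wt_dual g)
  simp only [wt, List.map_cons, List.map_nil, List.sum_cons, List.sum_nil] at h
  push_cast at h
  rw [← h]
  simp only [phi, w0, wt, List.map_cons, List.map_nil, List.sum_cons, List.sum_nil]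
  simp

theorem w0_deg : w0.totalDegree ≤ 2 := by
  unfold w0
  refine (totalDegree_add _ _).trans (max_le ((totalDegree_add _ _).trans (max_le ?_ ?_)) ?_)
  · simp
  · simp
  · refine (totalDegree_mul _ _).trans ?_
    simp

theorem w0_li : LinearIndependent ℂ
    (fun g : alternatingGroup (Fin 4) => rename (g : Equiv.Perm (Fin 4)) w0) := by
  rw [Fintype.linearIndependent_iff]
  intro c hc h
  have h1 := congrArg (fun p => phi (rename ((h⁻¹ : alternatingGroup (Fin 4)) :
    Equiv.Perm (Fin 4)) p)) hc
  have h2 : ∀ g : alternatingGroup (Fin 4),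
      phi (rename ((h⁻¹ : alternatingGroup (Fin 4)) : Equiv.Perm (Fin 4))
        (rename (g : Equiv.Perm (Fin 4)) w0)) = if h = g then 8 else 0 := by
    intro g
    rw [rename_rename, ← Equiv.Perm.coe_mul, ← Subgroup.coe_mul, phi_w0]
    simp [inv_mul_eq_one]
  simp only [map_sum, map_smul, h2, map_zero] at h1
  simpa using h1

/-- Polynomials of degree at most one lie in the span of `1` and the variables. -/
theorem deg_one_mem (S : Submodule ℂ (MvPolynomial (Fin 4) ℂ)) (h1 : 1 ∈ S)
    (hX : ∀ i, X i ∈ S) (p : MvPolynomial (Fin 4) ℂ) (hp : p.totalDegree ≤ 1) : p ∈ S := by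
  rw [p.as_sum]
  refine S.sum_mem fun m hm => ?_
  have hd := (le_totalDegree hm).trans hp
  have : monomial m (coeff m p) = coeff m p • monomial m (1 : ℂ) := by
    simp [smul_monomial]
  rw [this]
  refine S.smul_mem _ ?_
  by_cases h0 : m = 0
  · subst h0; exact h1
  · obtain ⟨i, hi⟩ := Finsupp.ne_iff.1 h0
    have hle : Finsupp.single i 1 ≤ m := by
      rw [Finsupp.single_le_iff]; exact Nat.one_le_iff_ne_zero.2 hi
    obtain ⟨m', rfl⟩ := exists_add_of_le hle
    have hd' : Finsupp.degree (Finsupp.single i 1 + m') ≤ 1 := hd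
    rw [map_add, Finsupp.degree_single] at hd'
    have : m' = 0 := by
      rw [← Finsupp.degree_eq_zero_iff]; omega
    subst this
    rw [add_zero]
    exact hX i

theorem deg_two_mem (S : Submodule ℂ (MvPolynomial (Fin 4) ℂ)) (h1 : 1 ∈ S)
    (hX : ∀ i, X i ∈ S) (hXX : ∀ i j, X i * X j ∈ S)
    (p : MvPolynomial (Fin 4) ℂ) (hp : p.totalDegree ≤ 2) : p ∈ S := by
  rw [p.as_sum]
  refine S.sum_mem fun m hm => ?_
  have hd := (le_totalDegree hm).trans hp
  have : monomial m (coeff m p) = coeff m p • monomial m (1 : ℂ) := by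
    simp [smul_monomial]
  rw [this]
  refine S.smul_mem _ ?_
  by_cases h0 : m = 0
  · subst h0; exact h1
  · obtain ⟨i, hi⟩ := Finsupp.ne_iff.1 h0
    have hle : Finsupp.single i 1 ≤ m := by
      rw [Finsupp.single_le_iff]; exact Nat.one_le_iff_ne_zero.2 hi
    obtain ⟨m', rfl⟩ := exists_add_of_le hle
    have hd' : Finsupp.degree (Finsupp.single i 1 + m') ≤ 2 := hd
    rw [map_add, Finsupp.degree_single] at hd'
    have hmul : (monomial (Finsupp.single i 1 + m') (1 : ℂ)) = X i * monomial m' 1 := by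
      rw [X, monomial_mul, one_mul]
    rw [hmul]
    have hmem : monomial m' (1 : ℂ) ∈
        S.comap (LinearMap.mulLeft ℂ (X i : MvPolynomial (Fin 4) ℂ)) := by
      refine deg_one_mem _ ?_ ?_ _ ?_
      · simpa using hX i
      · intro j; simpa using hXX i j
      · refine (totalDegree_monomial_le _ _).trans ?_
        change Finsupp.degree m' ≤ 1
        omega
    simpa using hmem

/-- The signs killing all constants and linear forms. -/
def sgn1 (g : alternatingGroup (Fin 4)) : ℤ :=
  if a4Tup g ∈ ({(0, 1, 2, 3), (1, 0, 3, 2), (2, 3, 0, 1), (3, 2, 1, 0)} : Finset _) then 1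
  else if a4Tup g ∈ ({(0, 2, 3, 1), (1, 3, 2, 0), (2, 0, 1, 3), (3, 1, 0, 2)} : Finset _) then -1
  else 0

theorem sgn1_const : ∑ g, sgn1 g = 0 := by decide +kernel

theorem sgn1_lin : ∀ i j, ∑ g : alternatingGroup (Fin 4),
    (if (g : Equiv.Perm (Fin 4)) i = j then sgn1 g else 0) = 0 := by decide +kernel

theorem deg_one_dep (p : MvPolynomial (Fin 4) ℂ) (hp : p.totalDegree ≤ 1) :
    ∑ g : alternatingGroup (Fin 4), (sgn1 g : ℂ) • rename (g : Equiv.Perm (Fin 4)) p = 0 := by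
  let L : MvPolynomial (Fin 4) ℂ →ₗ[ℂ] MvPolynomial (Fin 4) ℂ :=
    ∑ g : alternatingGroup (Fin 4), (sgn1 g : ℂ) • (rename (g : Equiv.Perm (Fin 4)) :
      MvPolynomial (Fin 4) ℂ →ₐ[ℂ] MvPolynomial (Fin 4) ℂ).toLinearMap
  have hL : ∀ q, L q = ∑ g : alternatingGroup (Fin 4),
      (sgn1 g : ℂ) • rename (g : Equiv.Perm (Fin 4)) q := by
    intro q; simp [L]
  rw [← hL]
  refine deg_one_mem (LinearMap.ker L) ?_ ?_ p hp
  · rw [LinearMap.mem_ker, hL]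
    simp only [map_one]
    rw [← Finset.sum_smul, ← Int.cast_sum, sgn1_const]; simp
  · intro i
    rw [LinearMap.mem_ker, hL]
    simp only [rename_X]
    have h1 : ∀ g : alternatingGroup (Fin 4),
        (sgn1 g : ℂ) • (X ((g : Equiv.Perm (Fin 4)) i) : MvPolynomial (Fin 4) ℂ) =
        ∑ j, (((if (g : Equiv.Perm (Fin 4)) i = j then sgn1 g else 0 : ℤ)) : ℂ) •
          (X j : MvPolynomial (Fin 4) ℂ) := by
      intro g
      rw [Finset.sum_eq_single ((g : Equiv.Perm (Fin 4)) i)]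
      · simp
      · intro b _ hb; simp [hb.symm]
      · simp
    rw [Finset.sum_congr rfl fun g _ => h1 g, Finset.sum_comm]
    refine Finset.sum_eq_zero fun j _ => ?_
    rw [← Finset.sum_smul, ← Int.cast_sum, sgn1_lin]; simp

/-- The Vandermonde cofactors. -/
noncomputable def cof : Fin 4 → MvPolynomial (Fin 4) ℂ :=
  ![(X 1 - X 2) * (X 1 - X 3) * (X 2 - X 3), -((X 0 - X 2) * (X 0 - X 3) * (X 2 - X 3)),
    (X 0 - X 1) * (X 0 - X 3) * (X 1 - X 3), -((X 0 - X 1) * (X 0 - X 2) * (X 1 - X 2))]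

noncomputable def opL : MvPolynomial (Fin 4) ℂ →ₗ[ℂ] MvPolynomial (Fin 4) ℂ :=
  ∑ g : alternatingGroup (Fin 4), LinearMap.mulLeft ℂ (cof ((g : Equiv.Perm (Fin 4)) 0)) ∘ₗ
    (rename (g : Equiv.Perm (Fin 4)) :
      MvPolynomial (Fin 4) ℂ →ₐ[ℂ] MvPolynomial (Fin 4) ℂ).toLinearMap

theorem opL_apply (p : MvPolynomial (Fin 4) ℂ) : opL p = ∑ g : alternatingGroup (Fin 4),
    cof ((g : Equiv.Perm (Fin 4)) 0) * rename (g : Equiv.Perm (Fin 4)) p := by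
  simp [opL]

theorem opL_one : opL 1 = 0 := by
  rw [opL_apply]
  simp only [map_one]
  rw [a4_sum (fun a _ _ _ => cof a * 1)]
  simp [cof]; ring

theorem opL_X (i : Fin 4) : opL (X i) = 0 := by
  rw [opL_apply]
  simp only [rename_X]
  fin_cases i
  · refine (a4_sum (fun a _ _ _ => cof a * X a)).trans ?_
    simp [cof]; ring
  · refine (a4_sum (fun a b _ _ => cof a * X b)).trans ?_
    simp [cof]; ring
  · refine (a4_sum (fun a _ c _ => cof a * X c)).trans ?_
    simp [cof]; ring
  · refine (a4_sum (fun a _ _ d => cof a * X d)).trans ?_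
    simp [cof]; ring

theorem opL_XX (i j : Fin 4) : opL (X i * X j) = 0 := by
  have key := a4_sum (fun a b c d => cof a * (X (![a, b, c, d] i) * X (![a, b, c, d] j)))
  have h : ∀ (g : alternatingGroup (Fin 4)) (i : Fin 4), ![(g : Equiv.Perm (Fin 4)) 0,
      (g : Equiv.Perm (Fin 4)) 1, (g : Equiv.Perm (Fin 4)) 2, (g : Equiv.Perm (Fin 4)) 3] i
      = (g : Equiv.Perm (Fin 4)) i := by
    intro g i; fin_cases i <;> rfl
  simp only [h] at key
  rw [opL_apply]
  simp only [map_mul, rename_X]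
  rw [key]
  fin_cases i <;> fin_cases j <;> (simp [cof]; ring)

theorem opL_cube : opL (X 0 ^ 3) ≠ 0 := by
  intro h
  rw [opL_apply] at h
  simp only [map_pow, rename_X] at h
  rw [a4_sum (fun a _ _ _ => cof a * X a ^ 3)] at h
  have := congrArg (eval ![0, 1, 2, 3]) h
  simp [cof] at this
  norm_num at this

theorem opL_deg_two (p : MvPolynomial (Fin 4) ℂ) (hp : p.totalDegree ≤ 2) : opL p = 0 :=
  deg_two_mem (LinearMap.ker opL) opL_one opL_X opL_XX p hp

noncomputable def sA : Fin 3 → MvPolynomial (Fin 4) ℂ :=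
  ![1, X 0 * X 1 + X 2 * X 3, X 0 * X 2 + X 1 * X 3]

noncomputable def chB : Fin 4 → MvPolynomial (Fin 4) ℂ :=
  ![1, X 0 + X 1 - X 2 - X 3, X 0 - X 1 + X 2 - X 3, X 0 - X 1 - X 2 + X 3]

noncomputable def mA : Fin 3 → MvPolynomial (Fin 4) ℂ :=
  ![(X 0 * X 2 + X 1 * X 3) * (X 0 * X 1 + X 2 * X 3) - (X 0 * X 3 + X 1 * X 2) ^ 2,
    (X 0 * X 3 + X 1 * X 2) - (X 0 * X 1 + X 2 * X 3),
    (X 0 * X 3 + X 1 * X 2) - (X 0 * X 2 + X 1 * X 3)]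

noncomputable def lB : Fin 4 → MvPolynomial (Fin 4) ℂ :=
  ![chB 1 * chB 2 * chB 3, chB 2 * chB 3, chB 1 * chB 3, chB 1 * chB 2]

noncomputable def discD : MvPolynomial (Fin 4) ℂ :=
  (∑ a, mA a * sA a) * (∑ b, lB b * chB b)

theorem discD_ne : discD ≠ 0 := by
  intro h
  have := congrArg (eval ![0, 0, 1, 2]) h
  simp [discD, Fin.sum_univ_succ, mA, sA, lB, chB] at this
  norm_num at this

theorem orth (g : alternatingGroup (Fin 4)) :
    (∑ a, mA a * rename (g : Equiv.Perm (Fin 4)) (sA a)) *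
      (∑ b, lB b * rename (g : Equiv.Perm (Fin 4)) (chB b)) = if g = 1 then discD else 0 := by
  split_ifs with h1
  · subst h1
    simp [discD]
  · have hm := a4Tup_mem g
    have hne : a4Tup g ≠ (0, 1, 2, 3) := fun h => h1 (a4Tup_inj (h.trans rfl))
    simp only [a4List, Finset.mem_insert, Finset.mem_singleton] at hm
    rcases hm with hm | hm | hm | hm | hm | hm | hm | hm | hm | hm | hm | hm
    · exact absurd hm hne
    all_goals
      simp only [a4Tup, Prod.mk.injEq] at hm
      obtain ⟨e0, e1, e2, e3⟩ := hm
      simp [Fin.sum_univ_succ, mA, sA, lB, chB, e0, e1, e2, e3]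
      grind

theorem sA_chB_deg (a : Fin 3) (b : Fin 4) : (sA a * chB b).totalDegree ≤ 3 := by
  have hX : ∀ i : Fin 4, (X i : MvPolynomial (Fin 4) ℂ).totalDegree ≤ 1 := fun i => by simp
  have hXX : ∀ i j : Fin 4, (X i * X j : MvPolynomial (Fin 4) ℂ).totalDegree ≤ 2 :=
    fun i j => (totalDegree_mul _ _).trans (by simp)
  have ha : (sA a).totalDegree ≤ 2 := by
    fin_cases a
    · simp [sA]
    · exact (totalDegree_add _ _).trans (max_le (hXX _ _) (hXX _ _))
    · exact (totalDegree_add _ _).trans (max_le (hXX _ _) (hXX _ _))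
  have hadd : ∀ p q : MvPolynomial (Fin 4) ℂ, p.totalDegree ≤ 1 → q.totalDegree ≤ 1 →
    (p + q).totalDegree ≤ 1 := fun p q hp hq => (totalDegree_add _ _).trans (max_le hp hq)
  have hsub : ∀ p q : MvPolynomial (Fin 4) ℂ, p.totalDegree ≤ 1 → q.totalDegree ≤ 1 →
    (p - q).totalDegree ≤ 1 := fun p q hp hq => (totalDegree_sub _ _).trans (max_le hp hq)
  have hb : (chB b).totalDegree ≤ 1 := by
    fin_cases b
    · simp [chB]
    · exact hsub _ _ (hsub _ _ (hadd _ _ (hX _) (hX _)) (hX _)) (hX _)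
    · exact hsub _ _ (hadd _ _ (hsub _ _ (hX _) (hX _)) (hX _)) (hX _)
    · exact hadd _ _ (hsub _ _ (hsub _ _ (hX _) (hX _)) (hX _)) (hX _)
  exact (totalDegree_mul _ _).trans (by omega)

section

variable [MulSemiringAction (alternatingGroup (Fin 4)) (MvPolynomial (Fin 4) ℂ)]
  [MulSemiringAction (alternatingGroup (Fin 4)) (FractionRing (MvPolynomial (Fin 4) ℂ))]

local notation "𝔸" => MvPolynomial (Fin 4) ℂ
local notation "𝔽" => FractionRing (MvPolynomial (Fin 4) ℂ)
local notation "𝕂" =>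
  FixedPoints.subfield (alternatingGroup (Fin 4)) (FractionRing (MvPolynomial (Fin 4) ℂ))
local notation "ιF" =>
  algebraMap (MvPolynomial (Fin 4) ℂ) (FractionRing (MvPolynomial (Fin 4) ℂ))

/-- **Example (`D_reg < D_span` for the permutation representation of `A₄`).** Let
`V = ℂ⁴` be the canonical permutation representation of the alternating group `A₄`
(encoded: `A₄` permutes the variables of `ℂ[x₁,…,x₄]`).  Then `ℂ[V]_{≤2}` contains a
`ℂA₄`-submodule isomorphic to the regular representation `ℂA₄` (witnessed by a
normal-basis element), and `D_reg(A₄,V) = 2`; but `ℂ[V]_{≤2}` does not span `ℂ(V)` as a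
`ℂ(V)^{A₄}`-vector space, and in fact `D_span(A₄,V) = 3`.  In particular the inequality
`D_reg ≤ D_span` can be strict. -/
theorem alternating_four_Dreg_lt_Dspan
    [SMulCommClass (alternatingGroup (Fin 4)) ℂ (MvPolynomial (Fin 4) ℂ)]
    (hperm : ∀ (g : alternatingGroup (Fin 4)) (idx : Fin 4),
      g • (X idx : 𝔸) = X ((g : Equiv.Perm (Fin 4)) idx))
    (hcomp : ∀ (g : alternatingGroup (Fin 4)) (p : 𝔸), g • (ιF p) = ιF (g • p)) :
    -- a copy of the regular representation inside `ℂ[V]_{≤2}`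
    (∃ W : Submodule ℂ 𝔸,
      W ≤ MvPolynomial.restrictTotalDegree (Fin 4) ℂ 2 ∧
      (∀ (g : alternatingGroup (Fin 4)), ∀ p ∈ W, g • p ∈ W) ∧
      (∃ w₀ ∈ W, LinearIndependent ℂ (fun g : alternatingGroup (Fin 4) => g • w₀) ∧
        Submodule.span ℂ (Set.range fun g : alternatingGroup (Fin 4) => g • w₀) = W)) ∧
    -- `D_reg(A₄, V) = 2`
    sInf {e : ℕ | ∃ W : Submodule ℂ 𝔸,
        W ≤ MvPolynomial.restrictTotalDegree (Fin 4) ℂ e ∧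
        (∀ (g : alternatingGroup (Fin 4)), ∀ p ∈ W, g • p ∈ W) ∧
        (∃ w₀ ∈ W, LinearIndependent ℂ (fun g : alternatingGroup (Fin 4) => g • w₀) ∧
          Submodule.span ℂ (Set.range fun g : alternatingGroup (Fin 4) => g • w₀) = W)}
      = 2 ∧
    -- `ℂ[V]_{≤2}` does not span `ℂ(V)` over `ℂ(V)^{A₄}`
    Submodule.span 𝕂 (ιF '' {p : 𝔸 | p.totalDegree ≤ 2}) ≠ ⊤ ∧
    -- `D_span(A₄, V) = 3`
    sInf {e : ℕ | Submodule.span 𝕂 (ιF '' {p : 𝔸 | p.totalDegree ≤ e}) = ⊤} = 3 := by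

  have hren : ∀ (g : alternatingGroup (Fin 4)) (p : 𝔸),
      g • p = rename (g : Equiv.Perm (Fin 4)) p := by
    intro g p
    induction p using MvPolynomial.induction_on with
    | C a =>
      rw [← mul_one (C a), ← MvPolynomial.smul_eq_C_mul, smul_comm, smul_one]
      simp
    | add p q hp hq => rw [smul_add, hp, hq, map_add]
    | mul_X p i hp => rw [smul_mul', hp, hperm, map_mul, rename_X]
  have hreg : ∃ W : Submodule ℂ 𝔸,
      W ≤ MvPolynomial.restrictTotalDegree (Fin 4) ℂ 2 ∧
      (∀ (g : alternatingGroup (Fin 4)), ∀ p ∈ W, g • p ∈ W) ∧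
      (∃ w₀ ∈ W, LinearIndependent ℂ (fun g : alternatingGroup (Fin 4) => g • w₀) ∧
        Submodule.span ℂ (Set.range fun g : alternatingGroup (Fin 4) => g • w₀) = W) := by
    refine ⟨Submodule.span ℂ (Set.range fun g : alternatingGroup (Fin 4) => g • w0), ?_, ?_,
      w0, ?_, ?_, rfl⟩
    · rw [Submodule.span_le]
      rintro _ ⟨g, rfl⟩
      simp only [SetLike.mem_coe, mem_restrictTotalDegree]
      rw [hren]
      exact (totalDegree_rename_le _ _).trans w0_deg
    · intro g p hp
      induction hp using Submodule.span_induction with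
      | mem x hx =>
        obtain ⟨h, rfl⟩ := hx
        exact Submodule.subset_span ⟨g * h, mul_smul _ _ _⟩
      | zero => rw [smul_zero]; exact Submodule.zero_mem _
      | add x y _ _ hx hy => rw [smul_add]; exact Submodule.add_mem _ hx hy
      | smul a x _ hx => rw [smul_comm]; exact Submodule.smul_mem _ _ hx
    · exact Submodule.subset_span ⟨1, one_smul _ _⟩
    · simp only [hren]
      exact w0_li
  have hnot2 : Submodule.span 𝕂 (ιF '' {p : 𝔸 | p.totalDegree ≤ 2}) ≠ ⊤ := by
    intro htop
    let Λ : 𝔽 →ₗ[𝕂] 𝔽 :=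
      { toFun := fun y => ∑ g : alternatingGroup (Fin 4),
          ιF (cof ((g : Equiv.Perm (Fin 4)) 0)) * (g • y)
        map_add' := fun x y => by
          simp only [smul_add, mul_add, Finset.sum_add_distrib]
        map_smul' := fun k y => by
          simp only [RingHom.id_apply, Finset.smul_sum]
          refine Finset.sum_congr rfl fun g _ => ?_
          rw [Subfield.smul_def, Subfield.smul_def, smul_eq_mul, smul_eq_mul, smul_mul', k.2 g]
          ring }
    have hΛ : ∀ p : 𝔸, Λ (ιF p) = ιF (opL p) := by
      intro p
      change ∑ g : alternatingGroup (Fin 4),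
          ιF (cof ((g : Equiv.Perm (Fin 4)) 0)) * (g • ιF p) = _
      rw [opL_apply, map_sum]
      refine Finset.sum_congr rfl fun g _ => ?_
      rw [hcomp, hren, map_mul]
    have hle : Submodule.span 𝕂 (ιF '' {p : 𝔸 | p.totalDegree ≤ 2}) ≤ LinearMap.ker Λ := by
      rw [Submodule.span_le]
      rintro _ ⟨p, hp, rfl⟩
      rw [SetLike.mem_coe, LinearMap.mem_ker, hΛ, opL_deg_two p hp, map_zero]
    rw [htop] at hle
    have h3 : ιF (X 0 ^ 3) ∈ LinearMap.ker Λ := hle trivial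
    rw [LinearMap.mem_ker, hΛ] at h3
    exact opL_cube ((map_eq_zero_iff _ (IsFractionRing.injective 𝔸 𝔽)).1 h3)
  have hyes3 : Submodule.span 𝕂 (ιF '' {p : 𝔸 | p.totalDegree ≤ 3}) = ⊤ := by
    rw [eq_top_iff]
    rintro y -
    have hD : ιF discD ≠ 0 := fun h =>
      discD_ne ((map_eq_zero_iff _ (IsFractionRing.injective 𝔸 𝔽)).1 h)
    let z : 𝔽 := y * (ιF discD)⁻¹
    have htr : ∀ x : 𝔽, (∑ g : alternatingGroup (Fin 4), g • x) ∈ 𝕂 := by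
      intro x h
      change h • (∑ g : alternatingGroup (Fin 4), g • x) = _
      rw [Finset.smul_sum]
      simp only [← mul_smul]
      exact Fintype.sum_equiv (Equiv.mulLeft h) _ _ fun g => rfl
    have horth : ∀ g : alternatingGroup (Fin 4),
        ∑ a, ∑ b, ιF (mA a * lB b) * (g • ιF (sA a * chB b)) = if g = 1 then ιF discD else 0 := by
      intro g
      have h := congrArg ιF (orth g)
      rw [Finset.sum_mul_sum, apply_ite ιF, map_zero] at h
      rw [← h]
      simp only [map_sum]
      refine Finset.sum_congr rfl fun a _ => Finset.sum_congr rfl fun b _ => ?_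
      rw [hcomp, hren, ← map_mul, map_mul (rename _)]
      congr 1
      ring
    have hy : y = ∑ a, ∑ b, (⟨∑ g : alternatingGroup (Fin 4), g • (z * ιF (mA a * lB b)),
        htr _⟩ : 𝕂) • ιF (sA a * chB b) := by
      simp only [Subfield.smul_def, smul_eq_mul, Finset.sum_mul]
      have h1 : ∀ (a : Fin 3) (b : Fin 4) (g : alternatingGroup (Fin 4)),
          (g • (z * ιF (mA a * lB b))) * ιF (sA a * chB b) =
          g • (z * (ιF (mA a * lB b) * (g⁻¹ • ιF (sA a * chB b)))) := by
        intro a b g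
        rw [← mul_assoc, smul_mul' g (z * _), smul_inv_smul]
      simp only [h1]
      have h2 : ∀ g : alternatingGroup (Fin 4),
          ∑ a, ∑ b, g • (z * (ιF (mA a * lB b) * (g⁻¹ • ιF (sA a * chB b)))) =
          if g = 1 then y else 0 := by
        intro g
        simp only [← Finset.smul_sum, ← Finset.mul_sum]
        rw [horth]
        by_cases hg : g = 1
        · subst hg
          simp [z, hD]
        · simp [hg]
      calc y = ∑ g : alternatingGroup (Fin 4), if g = 1 then y else 0 := by simp
        _ = ∑ g : alternatingGroup (Fin 4), ∑ a, ∑ b,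
            g • (z * (ιF (mA a * lB b) * (g⁻¹ • ιF (sA a * chB b)))) :=
          Finset.sum_congr rfl fun g _ => (h2 g).symm
        _ = _ := by
          rw [Finset.sum_comm]
          refine Finset.sum_congr rfl fun a _ => ?_
          rw [Finset.sum_comm]
    rw [hy]
    refine Submodule.sum_mem _ fun a _ => Submodule.sum_mem _ fun b _ =>
      Submodule.smul_mem _ _ (Submodule.subset_span ⟨_, sA_chB_deg a b, rfl⟩)
  refine ⟨hreg, ?_, hnot2, ?_⟩
  · refine le_antisymm (Nat.sInf_le hreg) (le_csInf ⟨2, hreg⟩ ?_)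
    rintro e ⟨W, hW, -, w, hw, hli, -⟩
    by_contra! he
    have hdeg : w.totalDegree ≤ 1 :=
      ((mem_restrictTotalDegree _ _ _).1 (hW hw)).trans (by omega)
    simp only [hren] at hli
    have := Fintype.linearIndependent_iff.1 hli _ (deg_one_dep w hdeg) 1
    have h1 : sgn1 1 = 1 := by decide +kernel
    rw [h1] at this
    simp at this
  · refine le_antisymm (Nat.sInf_le hyes3) (le_csInf ⟨3, hyes3⟩ ?_)
    intro e he
    by_contra! hlt
    refine hnot2 (eq_top_iff.2 ?_)
    rw [← (show _ = ⊤ from he)]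
    refine Submodule.span_mono (Set.image_mono ?_)
    intro p hp
    exact le_trans (show p.totalDegree ≤ e from hp) (by omega)

end
end
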